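/- arXiv:1911.09866 — 4 statements merged into one kernel-verified Lean document; each statement's English description precedes it below -/
import Mathlib

section
/- Let CT be an n-vertex chemical tree with exactly k segments, where 3 ≤ k ≤ n−1. Then M1(CT) ≤ 4n+2k−10 if k ≡ 0 (mod 3); M1(CT) ≤ 4n+2k−8 if k ≡ 1 (mod 3); and M1(CT) ≤ 4n+2k−12 if k ≡ 2 (mod 3). Moreover, equality holds if and only if CT has exactly one vertex of degree 3 when k ≡ 0 (mod 3), no vertex of degree 3 when k ≡ 1 (mod 3), and exactly two vertices of degree 3 when k ≡ 2 (mod 3). -/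
open SimpleGraph

namespace ChemTree

variable {V : Type*}

/-- The degree of a vertex. -/
noncomputable def deg (G : SimpleGraph V) (v : V) : ℕ :=
  (G.neighborSet v).ncard

/-- A chemical tree: a tree in which every vertex has degree at most 4. -/
def IsChemicalTree (G : SimpleGraph V) : Prop :=
  G.IsTree ∧ ∀ v, deg G v ≤ 4

/-- `nDeg G i` is the number of vertices of `G` having degree `i`. -/
noncomputable def nDeg (G : SimpleGraph V) (i : ℕ) : ℕ :=
  {v | deg G v = i}.ncard

/-- The first Zagreb index. -/
noncomputable def M1 (G : SimpleGraph V) [Fintype V] : ℕ :=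
  ∑ v, (deg G v) ^ 2

/-- The second Zagreb index. -/
noncomputable def M2 (G : SimpleGraph V) [Fintype V] : ℕ :=
  ∑ e ∈ (Set.toFinite G.edgeSet).toFinset,
    Sym2.lift ⟨fun u w => deg G u * deg G w, fun u w => Nat.mul_comm _ _⟩ e

/-- A segment: a nontrivial path whose end vertices have degree `≠ 2` and whose
internal vertices all have degree `2`. -/
def IsSegment (G : SimpleGraph V) {u v : V} (p : G.Walk u v) : Prop :=
  p.IsPath ∧ 0 < p.length ∧ deg G u ≠ 2 ∧ deg G v ≠ 2 ∧
    ∀ w ∈ p.support, w ≠ u → w ≠ v → deg G w = 2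

/-- The number of segments: in a tree, a segment is uniquely determined by the
unordered pair of its end vertices. -/
noncomputable def numSegments (G : SimpleGraph V) : ℕ :=
  {s : Sym2 V | ∃ (u v : V) (p : G.Walk u v), s = s(u, v) ∧ IsSegment G p}.ncard

/-- The number of branching vertices (vertices of degree at least 3). -/
noncomputable def numBranching (G : SimpleGraph V) : ℕ :=
  {v | 3 ≤ deg G v}.ncard

/-- An internal path: both end vertices are branching and all internal vertices
have degree `2`. -/
def IsInternalPath (G : SimpleGraph V) {u v : V} (p : G.Walk u v) : Prop :=
  p.IsPath ∧ 0 < p.length ∧ 3 ≤ deg G u ∧ 3 ≤ deg G v ∧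
    ∀ w ∈ p.support, w ≠ u → w ≠ v → deg G w = 2

/-- A pendent path: one end vertex is pendent, the other is branching and all
internal vertices have degree `2`. -/
def IsPendentPath (G : SimpleGraph V) {u v : V} (p : G.Walk u v) : Prop :=
  p.IsPath ∧ 0 < p.length ∧ deg G u = 1 ∧ 3 ≤ deg G v ∧
    ∀ w ∈ p.support, w ≠ u → w ≠ v → deg G w = 2

end ChemTree

namespace ChemTree

variable {V : Type*}

/-- In a tree, the neighbour of `u` that is closer to the root `r` is unique. -/
theorem parent_unique {G : SimpleGraph V} (hG : G.IsTree) {r u a b : V}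
    (ha : G.Adj u a) (hb : G.Adj u b) (hda : G.dist r u = G.dist r a + 1)
    (hdb : G.dist r u = G.dist r b + 1) : a = b := by
  obtain ⟨p, hp⟩ := hG.connected.exists_walk_length_eq_dist a r
  obtain ⟨q, hq⟩ := hG.connected.exists_walk_length_eq_dist b r
  rw [G.dist_comm] at hp hq
  have h1 : (Walk.cons ha p).IsPath :=
    Walk.isPath_of_length_eq_dist _ (by rw [Walk.length_cons, G.dist_comm (u := u)]; omega)
  have h2 : (Walk.cons hb q).IsPath :=
    Walk.isPath_of_length_eq_dist _ (by rw [Walk.length_cons, G.dist_comm (u := u)]; omega)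
  have h3 := (hG.existsUnique_path u r).unique h1 h2
  simpa using congrArg Walk.snd h3

theorem exists_parent {G : SimpleGraph V} (hG : G.IsTree) {r u : V} (hu : u ≠ r) :
    ∃ a, G.Adj u a ∧ G.dist r u = G.dist r a + 1 := by
  obtain ⟨p, hp⟩ := hG.connected.exists_walk_length_eq_dist u r
  cases p with
  | nil => exact absurd rfl hu
  | @cons _ a _ h p =>
    refine ⟨a, h, ?_⟩
    have h1 := G.dist_le p
    rw [Walk.length_cons, G.dist_comm] at hp
    rw [G.dist_comm] at h1
    have h2 := hG.dist_eq_dist_add_one_of_adj r h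
    omega

/-- `Climb G r u v`: walking from `u` towards the root `r`, the first vertex of degree `≠ 2`
met after `u` is `v`. -/
inductive Climb (G : SimpleGraph V) (r : V) : V → V → Prop
  | base {u a : V} (h : G.Adj u a) (hd : G.dist r u = G.dist r a + 1) (ha : deg G a ≠ 2) :
      Climb G r u a
  | step {u a v : V} (h : G.Adj u a) (hd : G.dist r u = G.dist r a + 1) (ha : deg G a = 2)
      (hc : Climb G r a v) : Climb G r u v

namespace Climb

variable {G : SimpleGraph V} {r u v w : V}

theorem unique (hG : G.IsTree) (h : Climb G r u v) (h' : Climb G r u w) : v = w := by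
  induction h with
  | base h hd ha =>
    cases h' with
    | base h' hd' ha' => exact parent_unique hG h h' hd hd'
    | step h' hd' ha' hc => exact absurd (parent_unique hG h h' hd hd' ▸ ha') ha
  | step h hd ha hc ih =>
    cases h' with
    | base h' hd' ha' => exact absurd (parent_unique hG h h' hd hd' ▸ ha) ha'
    | step h' hd' ha' hc' => exact ih (parent_unique hG h h' hd hd' ▸ hc')

theorem deg_ne (h : Climb G r u v) : deg G v ≠ 2 := by
  induction h with
  | base h hd ha => exact ha
  | step h hd ha hc ih => exact ih

theorem dist_lt (h : Climb G r u v) : G.dist r v < G.dist r u := by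
  induction h with
  | base h hd ha => omega
  | step h hd ha hc ih => omega

theorem exists_climb (hG : G.IsTree) (hr : deg G r ≠ 2) (hu : u ≠ r) :
    ∃ v, Climb G r u v := by
  induction hn : G.dist r u using Nat.strong_induction_on generalizing u with
  | _ n ih =>
    obtain ⟨a, h, hd⟩ := exists_parent hG hu
    by_cases ha : deg G a = 2
    · obtain ⟨v, hv⟩ := ih (G.dist r a) (by omega) (u := a) (by rintro rfl; exact hr ha) rfl
      exact ⟨v, .step h hd ha hv⟩
    · exact ⟨a, .base h hd ha⟩

theorem exists_path (h : Climb G r u v) :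
    ∃ p : G.Walk u v, p.IsPath ∧ 0 < p.length ∧
      (∀ w ∈ p.support, w ≠ u → w ≠ v → deg G w = 2) ∧
      ∀ w ∈ p.support, G.dist r w ≤ G.dist r u := by
  induction h with
  | base h hd ha =>
    refine ⟨Walk.cons h .nil, by simp [h.ne], by simp, ?_, ?_⟩
    · simp +contextual
    · simp; omega
  | @step u a v h hd ha hc ih =>
    obtain ⟨p, hp, -, hi, hle⟩ := ih
    refine ⟨Walk.cons h p, ?_, by simp, ?_, ?_⟩
    · rw [Walk.cons_isPath_iff]
      refine ⟨hp, fun hu => ?_⟩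
      have := hle _ hu
      omega
    · intro w hw hwu hwv
      rw [Walk.support_cons, List.mem_cons] at hw
      rcases hw with rfl | hw
      · exact absurd rfl hwu
      · by_cases hwa : w = a
        · exact hwa ▸ ha
        · exact hi w hw hwa hwv
    · intro w hw
      rw [Walk.support_cons, List.mem_cons] at hw
      rcases hw with rfl | hw
      · exact le_rfl
      · have := hle w hw
        omega

theorem of_isPath [Finite V] (hG : G.IsTree) (hr : deg G r ≠ 2) {a : V} (h : G.Adj u a)
    (p : G.Walk a v) (hp : (Walk.cons h p).IsPath)
    (hi : ∀ w ∈ p.support, w ≠ v → deg G w = 2) (hv : deg G v ≠ 2)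
    (hd : G.dist r u = G.dist r a + 1) : Climb G r u v := by
  induction p generalizing u with
  | nil => exact .base h hd hv
  | @cons a b v h' p ih =>
    rw [Walk.cons_isPath_iff] at hp
    obtain ⟨hp, hu⟩ := hp
    have hav : a ≠ v := by
      rintro rfl
      rw [Walk.cons_isPath_iff] at hp
      exact hp.2 p.end_mem_support
    have ha : deg G a = 2 := hi a (by simp) hav
    have har : a ≠ r := by rintro rfl; exact hr ha
    obtain ⟨c, hc, hdc⟩ := exists_parent hG har
    have hub : u ≠ b := by
      rintro rfl
      exact hu (by simp)
    have huc : u ≠ c := by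
      rintro rfl
      omega
    have hbc : b = c := by
      by_contra hbc
      have h3 : ({u, b, c} : Set V).ncard = 3 := by
        rw [Set.ncard_eq_three]
        exact ⟨u, b, c, hub, huc, hbc, rfl⟩
      have hsub : ({u, b, c} : Set V) ⊆ G.neighborSet a := by
        rintro x (rfl | rfl | rfl)
        exacts [h.symm, h', hc]
      have := Set.ncard_le_ncard hsub (Set.toFinite _)
      unfold deg at ha
      omega
    subst hbc
    exact .step h hd ha
      (ih h' hp (fun w hw => hi w (by rw [Walk.support_cons]; exact List.mem_cons_of_mem _ hw))
        hv hdc)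

end Climb

/-- A nontrivial path in a rooted tree goes up at its first step or, read backwards, goes up at
its last step. -/
theorem snd_up_or_penultimate_up {G : SimpleGraph V} (hG : G.IsTree) (r : V) {u v : V}
    (p : G.Walk u v) (hp : p.IsPath) (hn : ¬ p.Nil) :
    G.dist r u = G.dist r p.snd + 1 ∨ G.dist r v = G.dist r p.penultimate + 1 := by
  induction p with
  | nil => simp at hn
  | @cons u a v h p ih =>
    have h1 := hG.dist_eq_dist_add_one_of_adj r h
    cases p with
    | nil => simpa using h1
    | @cons _ b _ h' p =>
      rcases ih hp.of_cons (by simp) with h2 | h2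
      · left
        simp only [Walk.snd_cons] at h2 ⊢
        rcases h1 with h1 | h1
        · exact h1
        · exfalso
          have hub := parent_unique hG h.symm h' h1 h2
          rw [Walk.cons_isPath_iff] at hp
          exact hp.2 (by simp [hub])
      · right
        rwa [Walk.penultimate_cons_cons]

theorem climb_of_isSegment_of_up [Finite V] {G : SimpleGraph V} (hG : G.IsTree) {r u v : V}
    (hr : deg G r ≠ 2) {p : G.Walk u v} (hp : IsSegment G p)
    (hup : G.dist r u = G.dist r p.snd + 1) : Climb G r u v := by
  obtain ⟨hp, hl, hu, hv, hi⟩ := hp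
  cases p with
  | nil => simp at hl
  | cons h p =>
    refine Climb.of_isPath hG hr h p hp (fun w hw hwv => ?_) hv (by simpa using hup)
    refine hi w (by rw [Walk.support_cons]; exact List.mem_cons_of_mem _ hw) ?_ hwv
    rintro rfl
    rw [Walk.cons_isPath_iff] at hp
    exact hp.2 hw

theorem IsSegment.reverse {G : SimpleGraph V} {u v : V} {p : G.Walk u v} (hp : IsSegment G p) :
    IsSegment G p.reverse := by
  obtain ⟨hp, hl, hu, hv, hi⟩ := hp
  exact ⟨hp.reverse, by simpa using hl, hv, hu, fun w hw h1 h2 => hi w (by simpa using hw) h2 h1⟩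

theorem IsSegment.climb [Finite V] {G : SimpleGraph V} (hG : G.IsTree) {r u v : V}
    (hr : deg G r ≠ 2) {p : G.Walk u v} (hp : IsSegment G p) : Climb G r u v ∨ Climb G r v u := by
  have hn : ¬ p.Nil := by
    rw [← Walk.length_eq_zero_iff]
    exact hp.2.1.ne'
  rcases snd_up_or_penultimate_up hG r p hp.1 hn with h | h
  · exact .inl (climb_of_isSegment_of_up hG hr hp h)
  · exact .inr (climb_of_isSegment_of_up hG hr hp.reverse (by rwa [Walk.snd_reverse]))

/-- A tree with a vertex of degree `≠ 2` has one segment fewer than it has such vertices. -/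
theorem numSegments_add_one [Finite V] {G : SimpleGraph V} (hG : G.IsTree) {r : V}
    (hr : deg G r ≠ 2) : numSegments G + 1 = {v | deg G v ≠ 2}.ncard := by
  have hex : ∀ u, ∃ v, u ≠ r → Climb G r u v := fun u => by
    by_cases hu : u = r
    · exact ⟨u, fun h => absurd hu h⟩
    · obtain ⟨v, hv⟩ := Climb.exists_climb hG hr hu
      exact ⟨v, fun _ => hv⟩
  choose f hf using hex
  have hne : ∀ {u v}, Climb G r u v → u ≠ r := by
    rintro u v h rfl
    have := h.dist_lt
    simp at this
  have himage : {s : Sym2 V | ∃ (u v : V) (p : G.Walk u v), s = s(u, v) ∧ IsSegment G p} =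
      (fun u => s(u, f u)) '' ({v | deg G v ≠ 2} \ {r}) := by
    ext s
    constructor
    · rintro ⟨u, v, p, rfl, hp⟩
      rcases hp.climb hG hr with h | h
      · exact ⟨u, ⟨hp.2.2.1, hne h⟩, by simp only [(hf u (hne h)).unique hG h]⟩
      · exact ⟨v, ⟨hp.2.2.2.1, hne h⟩, by
          simp only [(hf v (hne h)).unique hG h]; exact Sym2.eq_swap⟩
    · rintro ⟨u, ⟨hu, hur⟩, rfl⟩
      have hc := hf u hur
      obtain ⟨p, hp, hl, hi, -⟩ := hc.exists_path
      exact ⟨u, f u, p, rfl, hp, hl, hu, hc.deg_ne, hi⟩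
  have hinj : Set.InjOn (fun u => s(u, f u)) ({v | deg G v ≠ 2} \ {r}) := by
    rintro u ⟨-, hu⟩ v ⟨-, hv⟩ huv
    rcases Sym2.eq_iff.mp huv with ⟨h, -⟩ | ⟨h1, h2⟩
    · exact h
    · have h3 := (hf u hu).dist_lt
      have h4 := (hf v hv).dist_lt
      rw [h2] at h3
      rw [← h1] at h4
      omega
  rw [numSegments, himage, hinj.ncard_image]
  exact Set.ncard_sdiff_singleton_add_one hr (Set.toFinite _)

theorem sum_deg_add_two [Fintype V] {G : SimpleGraph V} (hG : G.IsTree) :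
    ∑ v, deg G v + 2 = 2 * Fintype.card V := by
  classical
  have h1 := G.sum_degrees_eq_twice_card_edges
  have h2 := hG.card_edgeFinset
  have h3 : ∀ v, deg G v = G.degree v := fun v => by
    rw [deg, Set.ncard_eq_toFinset_card', ← SimpleGraph.neighborFinset_def,
      card_neighborFinset_eq_degree]
  simp only [h3]
  omega

theorem one_le_deg [Finite V] [Nontrivial V] {G : SimpleGraph V} (hG : G.Connected) (v : V) :
    1 ≤ deg G v := by
  obtain ⟨w, hw⟩ := hG.preconnected.exists_adj_of_nontrivial v
  exact (Set.ncard_pos (Set.toFinite _)).mpr ⟨w, hw⟩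

theorem ncard_eq_sum_ite [Fintype V] (P : V → Prop) [DecidablePred P] :
    {v | P v}.ncard = ∑ v, if P v then 1 else 0 := by
  rw [Set.ncard_eq_toFinset_card', Finset.sum_boole]
  simp

theorem M1_add [Fintype V] [Nontrivial V] {G : SimpleGraph V} (hG : IsChemicalTree G) :
    M1 G + 6 * Fintype.card V + 2 * nDeg G 3 =
      5 * ∑ v, deg G v + 2 * {v | deg G v ≠ 2}.ncard := by
  rw [M1, nDeg, ncard_eq_sum_ite, ncard_eq_sum_ite, ← Finset.card_univ, Finset.card_eq_sum_ones]
  simp only [Finset.mul_sum, ← Finset.sum_add_distrib]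
  refine Finset.sum_congr rfl fun v _ => ?_
  have h1 := one_le_deg hG.1.connected v
  have h4 := hG.2 v
  interval_cases deg G v <;> rfl

theorem ncard_deg_ne_two_add [Fintype V] [Nontrivial V] {G : SimpleGraph V}
    (hG : IsChemicalTree G) :
    {v | deg G v ≠ 2}.ncard + ∑ v, deg G v =
      2 * Fintype.card V + 2 * nDeg G 3 + 3 * nDeg G 4 := by
  rw [nDeg, nDeg, ncard_eq_sum_ite, ncard_eq_sum_ite, ncard_eq_sum_ite, ← Finset.card_univ,
    Finset.card_eq_sum_ones]
  simp only [Finset.mul_sum, ← Finset.sum_add_distrib]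
  refine Finset.sum_congr rfl fun v _ => ?_
  have h1 := one_le_deg hG.1.connected v
  have h4 := hG.2 v
  interval_cases deg G v <;> rfl

end ChemTree

open ChemTree

theorem stmt_1 {V : Type*} [Fintype V] (n k : ℕ)
    (hcard : Fintype.card V = n) (hk3 : 3 ≤ k) (hkn : k + 1 ≤ n)
    (T : SimpleGraph V) (hT : IsChemicalTree T) (hseg : numSegments T = k) :
    (k % 3 = 0 →
      (M1 T : ℚ) ≤ 4 * n + 2 * k - 10 ∧
        ((M1 T : ℚ) = 4 * n + 2 * k - 10 ↔ nDeg T 3 = 1)) ∧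
    (k % 3 = 1 →
      (M1 T : ℚ) ≤ 4 * n + 2 * k - 8 ∧
        ((M1 T : ℚ) = 4 * n + 2 * k - 8 ↔ nDeg T 3 = 0)) ∧
    (k % 3 = 2 →
      (M1 T : ℚ) ≤ 4 * n + 2 * k - 12 ∧
        ((M1 T : ℚ) = 4 * n + 2 * k - 12 ↔ nDeg T 3 = 2)) := by
  have : Nontrivial V := Fintype.one_lt_card_iff_nontrivial.mp (by omega)
  obtain ⟨r, hr⟩ : ∃ r, deg T r ≠ 2 := by
    have hpos : 0 < numSegments T := by omega
    obtain ⟨-, u, v, p, -, hp⟩ := Set.nonempty_of_ncard_ne_zero hpos.ne'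
    exact ⟨u, hp.2.2.1⟩
  have h1 := numSegments_add_one hT.1 hr
  have h2 := sum_deg_add_two hT.1
  have h3 := M1_add hT
  have h4 := ncard_deg_ne_two_add hT
  have hmod : k = 2 * nDeg T 3 + 3 * nDeg T 4 + 1 := by omega
  have hM : M1 T + 2 * nDeg T 3 + 8 = 4 * n + 2 * k := by omega
  have hMQ : (M1 T : ℚ) = 4 * n + 2 * k - 8 - 2 * nDeg T 3 := by
    have : (M1 T : ℚ) + 2 * nDeg T 3 + 8 = 4 * n + 2 * k := by exact_mod_cast hM
    linarith
  have key : ∀ c : ℕ, c ≤ nDeg T 3 → ∀ d : ℚ, d = 8 + 2 * c →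
      (M1 T : ℚ) ≤ 4 * n + 2 * k - d ∧ ((M1 T : ℚ) = 4 * n + 2 * k - d ↔ nDeg T 3 = c) := by
    intro c hc d hd
    have hc' : (c : ℚ) ≤ nDeg T 3 := by exact_mod_cast hc
    refine ⟨by linarith, fun h => ?_, fun h => ?_⟩
    · have : (nDeg T 3 : ℚ) = c := by linarith
      exact_mod_cast this
    · rw [hMQ, h, hd]
      ring
  exact ⟨fun _ => key 1 (by omega) 10 (by norm_num),
    fun _ => key 0 (by omega) 8 (by norm_num),
    fun _ => key 2 (by omega) 12 (by norm_num)⟩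
end

section
/- Let BT be an n-vertex chemical tree with exactly b branching vertices, where 1 ≤ b < n/2 − 1. Then M2(BT) ≤ 4n+16b−12 if 1 ≤ b ≤ (n−4)/5; M2(BT) ≤ 6n+6b−20 if (n−4)/5 < b < (n−2)/3; M2(BT) ≤ 10n−6b−28 if (n−2)/3 ≤ b < (3n−4)/7; and M2(BT) ≤ 16n−20b−36 if (3n−4)/7 ≤ b < n/2 − 1. Equality holds if and only if: in the case 1 ≤ b < (n−2)/3, BT has exactly b vertices of degree 4, n−3b−2 vertices of degree 2, 2b+2 vertices of degree 1 and no vertex of degree 3; in the case (n−2)/3 ≤ b < n/2 − 1, BT has exactly n−2b−2 vertices of degree 4, 3b−n+2 vertices of degree 3, n−b vertices of degree 1 and no vertex of degree 2; and in both cases BT additionally satisfies: every internal path (if any exists) has length 1; if some vertex of degree 4 has a pendent neighbor then no two vertices of degree 3 are adjacent; if some branching vertex has a pendent neighbor then BT has no pendent path of length greater than 2; every vertex of degree 3 (if any exists) has at most one neighbor of degree 4; and BT has at least one vertex of degree 4 and the subgraph induced by the vertices of degree 4 is a tree. -/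
open SimpleGraph

namespace ChemTree

variable {V : Type*}

/-- The structural properties appearing in the equality case of Theorem 4. -/
def MaxBranchProps (T : SimpleGraph V) : Prop :=
  (∀ (u v : V) (p : T.Walk u v), IsInternalPath T p → p.length = 1) ∧
  ((∃ u v : V, deg T u = 1 ∧ deg T v = 4 ∧ T.Adj u v) →
    ∀ x y : V, deg T x = 3 → deg T y = 3 → ¬ T.Adj x y) ∧
  ((∃ u v : V, deg T u = 1 ∧ 3 ≤ deg T v ∧ T.Adj u v) →
    ∀ (u v : V) (p : T.Walk u v), IsPendentPath T p → p.length ≤ 2) ∧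
  (∀ v : V, deg T v = 3 → {w | T.Adj v w ∧ deg T w = 4}.ncard ≤ 1) ∧
  ((∃ v : V, deg T v = 4) ∧ (T.induce {v | deg T v = 4}).IsTree)

end ChemTree


namespace ChemTree

open Finset

section Forest

variable {V : Type*} {G : SimpleGraph V}

theorem card_edgeSet_add_one_le_of_isAcyclic [Finite V] [Nonempty V] (hG : G.IsAcyclic) :
    Nat.card G.edgeSet + 1 ≤ Nat.card V ∧
      (Nat.card G.edgeSet + 1 = Nat.card V → G.IsTree) := by
  classical
  obtain ⟨T, hGT, -, hT⟩ := connected_top.exists_isTree_le_of_le_of_isAcyclic (le_top (a := G)) hG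
  have hcard := (isTree_iff_connected_and_card.1 hT).2
  have hsub : G.edgeSet ⊆ T.edgeSet := edgeSet_mono hGT
  refine ⟨hcard ▸ Nat.add_le_add_right (Nat.card_mono (Set.toFinite _) hsub) 1, fun h ↦ ?_⟩
  have : G.edgeSet = T.edgeSet :=
    Set.eq_of_subset_of_ncard_le hsub (by
      simp only [← Nat.card_coe_set_eq]
      omega)
  rwa [edgeSet_inj.1 this]

/-- In an acyclic graph, a path between two vertices of a set inducing a connected subgraph stays
inside that set. -/
theorem support_subset_of_preconnected_induce (hG : G.IsAcyclic) {S : Set V}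
    (hS : (G.induce S).Preconnected) {u v : V} (hu : u ∈ S) (hv : v ∈ S) {p : G.Walk u v}
    (hp : p.IsPath) : ∀ w ∈ p.support, w ∈ S := by
  obtain ⟨q, hq⟩ := (hS ⟨u, hu⟩ ⟨v, hv⟩).exists_isPath
  have hq' : (q.map (Embedding.induce (G := G) S).toHom).IsPath :=
    hq.map (Embedding.induce (G := G) S).injective
  have := congrArg Subtype.val ((hG.subsingleton_path u v).elim ⟨p, hp⟩ ⟨_, hq'⟩)
  simp only at this
  intro w hw
  replace hw : w ∈ (q.map (Embedding.induce (G := G) S).toHom).support := this ▸ hw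
  rw [Walk.support_map, List.mem_map] at hw
  obtain ⟨x, -, rfl⟩ := hw
  exact x.2

theorem exists_deg_two_of_isInternalPath {u v : V} {p : G.Walk u v}
    (hp : IsInternalPath G p)
    (h : p.length ≠ 1) : ∃ w ∈ p.support, deg G w = 2 := by
  obtain ⟨hp, h0, -, -, h2⟩ := hp
  refine ⟨p.getVert 1, p.getVert_mem_support 1, h2 _ (p.getVert_mem_support 1) ?_ ?_⟩
  · rw [Ne, hp.getVert_eq_start_iff h0]
    norm_num
  · rw [Ne, hp.getVert_eq_end_iff h0]
    exact h.symm

end Forest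

section Counting

variable {V : Type*} [Fintype V] (G : SimpleGraph V)

open Classical in
/-- The number of ordered pairs of adjacent vertices whose degrees are `i` and `j`. -/
noncomputable def numDarts (i j : ℕ) : ℕ :=
  #{d : G.Dart | deg G d.fst = i ∧ deg G d.snd = j}

theorem numDarts_comm (i j : ℕ) : numDarts G i j = numDarts G j i := by
  classical
  refine card_bij (fun d _ ↦ d.symm) ?_ ?_ ?_
  · simp +contextual
  · intro a _ b _ h
    exact Dart.symm_involutive.injective h
  · intro d hd
    exact ⟨d.symm, by simpa [and_comm] using hd, d.symm_symm⟩

theorem numDarts_eq_zero_iff {i j : ℕ} :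
    numDarts G i j = 0 ↔ ∀ u v, G.Adj u v → deg G u = i → deg G v ≠ j := by
  classical
  rw [numDarts, card_eq_zero, filter_eq_empty_iff]
  constructor
  · intro h u v huv hu hv
    exact h (mem_univ (⟨(u, v), huv⟩ : G.Dart)) ⟨hu, hv⟩
  · rintro h d - ⟨hu, hv⟩
    exact h _ _ d.adj hu hv

theorem deg_eq_degree [DecidableRel G.Adj] (v : V) : deg G v = G.degree v := by
  rw [deg, ← Nat.card_coe_set_eq, Nat.card_eq_fintype_card, card_neighborSet_eq_degree]

open Classical in
theorem nDeg_eq_card (i : ℕ) : nDeg G i = #{v | deg G v = i} := by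
  rw [nDeg, Set.ncard_eq_toFinset_card']
  congr 1
  ext
  simp

variable {G}

open Classical in
theorem sum_darts_eq (h0 : ∀ v, 1 ≤ deg G v) (h4 : ∀ v, deg G v ≤ 4) (f : ℕ → ℕ → ℕ) :
    ∑ d : G.Dart, f (deg G d.fst) (deg G d.snd) =
      ∑ i ∈ Icc 1 4, ∑ j ∈ Icc 1 4, numDarts G i j * f i j := by
  rw [← sum_product', ← sum_fiberwise_of_maps_to (s := univ) (t := Icc 1 4 ×ˢ Icc 1 4)
    (g := fun d : G.Dart ↦ (deg G d.fst, deg G d.snd)) (by simp [h0, h4])]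
  refine sum_congr rfl fun x _ ↦ ?_
  rw [numDarts, ← smul_eq_mul, ← sum_const]
  refine sum_congr (by ext; simp [Prod.ext_iff]) fun d hd ↦ ?_
  rw [mem_filter] at hd
  rw [hd.2.1, hd.2.2]

theorem mul_nDeg_eq (h0 : ∀ v, 1 ≤ deg G v) (h4 : ∀ v, deg G v ≤ 4) {i : ℕ}
    (hi : i ∈ Icc 1 4) : i * nDeg G i = ∑ j ∈ Icc 1 4, numDarts G i j := by
  classical
  have h := sum_darts_eq h0 h4 fun a _ ↦ if a = i then 1 else 0
  rw [sum_eq_single i (by simp +contextual) (by simp [hi])] at h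
  simp only [if_true, mul_one] at h
  rw [← h, ← sum_fiberwise_of_maps_to (s := univ) (t := univ)
    (g := fun d : G.Dart ↦ d.fst) (by simp), nDeg_eq_card, mul_comm, ← smul_eq_mul, ← sum_const,
    sum_filter]
  refine sum_congr rfl fun v _ ↦ ?_
  rw [sum_congr rfl (g := fun _ ↦ if deg G v = i then 1 else 0)
    (fun d hd ↦ by rw [(mem_filter.1 hd).2]), sum_const, smul_eq_mul]
  have hv := G.dart_fst_fiber_card_eq_degree v
  rw [← deg_eq_degree] at hv
  rw [show #{d : G.Dart | d.fst = v} = deg G v by convert hv]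
  split_ifs with hv <;> simp [hv]

theorem two_mul_M2 (h0 : ∀ v, 1 ≤ deg G v) (h4 : ∀ v, deg G v ≤ 4) :
    2 * M2 G = ∑ i ∈ Icc 1 4, ∑ j ∈ Icc 1 4, numDarts G i j * (i * j) := by
  classical
  rw [← sum_darts_eq h0 h4, M2, mul_sum,
    ← sum_fiberwise_of_maps_to (s := univ) (t := (Set.toFinite G.edgeSet).toFinset)
    (g := fun d : G.Dart ↦ d.edge) (by simp)]
  refine sum_congr rfl fun e he ↦ ?_
  rw [← dart_edge_fiber_card G e (by simpa using he), ← smul_eq_mul, ← sum_const]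
  refine sum_congr rfl fun d hd ↦ ?_
  rw [← (mem_filter.1 hd).2]
  rfl

theorem two_mul_card_edgeSet_induce (S : Set V) [DecidableRel G.Adj] [DecidablePred (· ∈ S)] :
    2 * Nat.card (G.induce S).edgeSet =
      ∑ d : G.Dart, if d.fst ∈ S ∧ d.snd ∈ S then 1 else 0 := by
  classical
  rw [Nat.card_eq_fintype_card, ← edgeFinset_card, ← dart_card_eq_twice_card_edges,
    ← card_filter, ← card_univ]
  refine card_bij (fun d _ ↦ ⟨(d.fst, d.snd), d.adj⟩) ?_ ?_ ?_
  · simp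
  · rintro ⟨⟨a, b⟩, _⟩ - ⟨⟨c, d⟩, _⟩ - h
    simpa [Dart.ext_iff, Prod.ext_iff, Subtype.ext_iff] using h
  · rintro ⟨⟨a, b⟩, hab⟩ h
    simp only [mem_filter, mem_univ, true_and] at h
    exact ⟨⟨(⟨a, h.1⟩, ⟨b, h.2⟩), hab⟩, mem_univ _, rfl⟩

end Counting

section Paths

variable {V : Type*} [Fintype V] {T : SimpleGraph V}

theorem two_le_deg {u v w : V} (hu : T.Adj v u) (hw : T.Adj v w) (huw : u ≠ w) : 2 ≤ deg T v :=
  (Set.one_lt_ncard_iff (Set.toFinite _)).2 ⟨u, w, hu, hw, huw⟩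

theorem eq_of_deg_eq_one {u v w : V} (hv : deg T v = 1) (hu : T.Adj v u) (hw : T.Adj v w) :
    u = w := by
  by_contra h
  have := two_le_deg hu hw h
  omega

theorem one_le_deg_s4 (hT : T.Connected) [Nontrivial V] (v : V) : 1 ≤ deg T v := by
  classical
  rw [deg_eq_degree]
  exact hT.preconnected.degree_pos_of_nontrivial v

theorem nontrivial_of_deg {r : V} (hr : 3 ≤ deg T r) : Nontrivial V := by
  have : (T.neighborSet r).Nonempty := by
    rw [← Set.ncard_pos (Set.toFinite _)]
    exact lt_of_lt_of_le (by norm_num) hr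
  obtain ⟨a, ha⟩ := this
  exact ⟨r, a, T.ne_of_adj ha⟩

theorem numDarts_one_one (hT : T.Connected) {r : V} (hr : 3 ≤ deg T r) :
    numDarts T 1 1 = 0 := by
  rw [numDarts_eq_zero_iff]
  intro u v huv hu hv
  obtain ⟨p⟩ := hT.preconnected u r
  obtain ⟨d, -, hd, hd'⟩ := p.exists_boundary_dart {u, v} (by simp) (by
    rintro (rfl | rfl) <;> omega)
  rcases hd with hd | hd
  · exact hd' (.inr (eq_of_deg_eq_one hu (hd ▸ d.adj) huv))
  · exact hd' (.inl (eq_of_deg_eq_one hv (hd ▸ d.adj) huv.symm))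

theorem length_le_two_of_numDarts_two_two (h : numDarts T 2 2 = 0) {u v : V} {p : T.Walk u v}
    (hp : IsPendentPath T p) : p.length ≤ 2 := by
  obtain ⟨hp, h0, -, -, h2⟩ := hp
  by_contra! hl
  have key : ∀ i, 0 < i → i < p.length → deg T (p.getVert i) = 2 := by
    intro i hi hi'
    refine h2 _ (p.getVert_mem_support i) ?_ ?_
    · rw [Ne, hp.getVert_eq_start_iff hi'.le]
      omega
    · rw [Ne, hp.getVert_eq_end_iff hi'.le]
      omega
  exact numDarts_eq_zero_iff T |>.1 h _ _ (p.adj_getVert_succ (i := 1) (by omega))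
    (key 1 (by omega) (by omega)) (key 2 (by omega) (by omega))

theorem numDarts_two_two_eq_zero (hT : T.IsTree) {r : V} (hr : 3 ≤ deg T r)
    (hS : (T.induce {v | 3 ≤ deg T v}).Preconnected)
    (h : ∀ (u v : V) (p : T.Walk u v), IsPendentPath T p → p.length ≤ 2) :
    numDarts T 2 2 = 0 := by
  classical
  have := nontrivial_of_deg hr
  rw [numDarts_eq_zero_iff]
  intro u v huv hu hv
  choose P hP using fun x ↦ (hT.existsUnique_path r x).exists
  have hPu {x : V} {p : T.Walk r x} (hp : p.IsPath) : p = P x :=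
    (hT.existsUnique_path r x).unique hp (hP x)
  wlog huv' : u ∈ (P v).support generalizing u v
  · exact this v u huv.symm hv hu
      (hT.isAcyclic.mem_support_of_ne_mem_support_of_adj_of_isPath (hP u) (hP v) huv huv')
  obtain ⟨l, hl, hmax⟩ := exists_max_image {x | v ∈ (P x).support} (fun x ↦ (P x).length)
    ⟨v, by simp⟩
  simp only [mem_filter, mem_univ, true_and] at hl hmax
  have hul : u ∈ (P l).support := by
    rw [← hPu ((hP l).takeUntil hl)] at huv'
    exact Walk.support_takeUntil_subset_support _ hl huv'
  have hl1 : deg T l = 1 := by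
    refine le_antisymm ?_ (one_le_deg_s4 hT.connected l)
    have hadj : ∀ y, T.Adj l y → y = (P l).penultimate := by
      intro y hy
      by_contra hne
      have hy' : y ∉ (P l).support := fun hy' ↦
        hne (hT.isAcyclic.eq_penultimate_of_adj_end (hP l) hy hy')
      have hPy := hPu ((hP l).concat hy' hy)
      have := hmax y (by rw [← hPy, Walk.support_concat]; simp [hl])
      rw [← hPy, Walk.length_concat] at this
      omega
    by_contra! hlt
    obtain ⟨a, b, ha, hb, hab⟩ := (Set.one_lt_ncard_iff (Set.toFinite _)).1 hlt
    exact hab ((hadj a ha).trans (hadj b hb).symm)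
  obtain ⟨q, hq, huq, hvq⟩ : ∃ q : T.Walk l r, q.IsPath ∧ u ∈ q.support ∧ v ∈ q.support :=
    ⟨(P l).reverse, (hP l).reverse, by simpa, by simpa⟩
  have hex : ∃ k, 3 ≤ deg T (q.getVert k) := ⟨q.length, by simpa⟩
  obtain ⟨k, hk, hmin⟩ : ∃ k, 3 ≤ deg T (q.getVert k) ∧ ∀ i < k, deg T (q.getVert i) < 3 :=
    ⟨Nat.find hex, Nat.find_spec hex, fun i hi ↦ not_le.1 (Nat.find_min hex hi)⟩
  have hkl : k ≤ q.length := by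
    by_contra! hlt
    have := hmin _ hlt
    rw [q.getVert_length] at this
    omega
  have hk0 : 0 < k := by
    rcases Nat.eq_zero_or_pos k with rfl | hk0
    · rw [q.getVert_zero] at hk
      omega
    · exact hk0
  have hlen : (q.take k).length = k := by simp [hkl]
  have hk2 : k ≤ 2 := by
    rw [← hlen]
    refine h _ _ _ ⟨hq.take k, by omega, hl1, hk, fun w hw hwl hwk ↦ ?_⟩
    obtain ⟨i, rfl, hi⟩ := Walk.mem_support_iff_exists_getVert.1 hw
    rw [hlen] at hi
    rw [Walk.take_getVert, min_eq_right hi] at *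
    have hi0 : i ≠ 0 := by
      rintro rfl
      exact hwl q.getVert_zero
    have hik : i ≠ k := by
      rintro rfl
      exact hwk rfl
    have hlt := hmin i (by omega)
    have hpred := q.adj_getVert_succ (i := i - 1) (by omega)
    have hsucc := q.adj_getVert_succ (i := i) (by omega)
    rw [Nat.sub_add_cancel (by omega)] at hpred
    have := two_le_deg hpred.symm hsucc fun heq ↦ by
      have := hq.getVert_injOn (by simp; omega) (by simp; omega) heq
      omega
    omega
  obtain ⟨i, hui, hi⟩ := Walk.mem_support_iff_exists_getVert.1 huq
  obtain ⟨j, hvj, hj⟩ := Walk.mem_support_iff_exists_getVert.1 hvq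
  have hlow : ∀ m, deg T (q.getVert m) = 2 → m < 2 := by
    intro m hm
    by_contra! hm2
    have hmem : q.getVert m ∈ (q.drop k).support := by
      have := (q.drop k).getVert_mem_support (m - k)
      rwa [Walk.drop_getVert, Nat.add_sub_cancel' (by omega)] at this
    have := support_subset_of_preconnected_induce hT.isAcyclic hS hk hr (hq.drop k) _ hmem
    simp only [Set.mem_ofPred_eq] at this
    omega
  have hpos : ∀ m, deg T (q.getVert m) = 2 → m ≠ 0 := by
    rintro m hm rfl
    rw [q.getVert_zero] at hm
    omega
  have hi2 := hlow i (hui ▸ hu)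
  have hj2 := hlow j (hvj ▸ hv)
  have hi0 := hpos i (hui ▸ hu)
  have hj0 := hpos j (hvj ▸ hv)
  obtain rfl : i = j := by omega
  exact huv.ne (hui.symm.trans hvj)

theorem ncard_adj_le_one_of_preconnected_induce (hT : T.IsAcyclic) {S : Set V}
    (hS : (T.induce S).Preconnected) {v : V} (hv : v ∉ S) : {w | T.Adj v w ∧ w ∈ S}.ncard ≤ 1 := by
  rw [Set.ncard_le_one (Set.toFinite _)]
  rintro a ⟨ha, haS⟩ b ⟨hb, hbS⟩
  by_contra hab
  refine hv (support_subset_of_preconnected_induce hT hS haS hbS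
    (p := .cons ha.symm (.cons hb .nil)) ?_ v (by simp))
  simp [hab, ha.ne', hb.ne]

end Paths

section Arithmetic

/-- The linear constraints relating the order `n`, the number `b` of branching vertices, the second
Zagreb index `M`, the numbers `nᵢ` of vertices of degree `i`, and the numbers `dᵢⱼ` of ordered
pairs of adjacent vertices of degrees `i` and `j` of a chemical tree. -/
structure DegreeRelations
    (n b M n₁ n₂ n₃ n₄ d₁₂ d₁₃ d₁₄ d₂₂ d₂₃ d₂₄ d₃₃ d₃₄ d₄₄ : ℕ) : Prop where
  deg_one : n₁ = d₁₂ + d₁₃ + d₁₄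
  deg_two : 2 * n₂ = d₁₂ + d₂₂ + d₂₃ + d₂₄
  deg_three : 3 * n₃ = d₁₃ + d₂₃ + d₃₃ + d₃₄
  deg_four : 4 * n₄ = d₁₄ + d₂₄ + d₃₄ + d₄₄
  order : n₁ + n₂ + n₃ + n₄ = n
  branching : n₃ + n₄ = b
  degree_sum : n₁ + 2 * n₂ + 3 * n₃ + 4 * n₄ + 2 = 2 * n
  forest_branching : d₃₃ + 2 * d₃₄ + d₄₄ + 2 ≤ 2 * b
  forest_four : 1 ≤ n₄ → d₄₄ + 2 ≤ 2 * n₄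
  zagreb : 2 * M = 4 * d₁₂ + 6 * d₁₃ + 8 * d₁₄ + 4 * d₂₂ + 12 * d₂₃ + 16 * d₂₄ + 9 * d₃₃ +
    24 * d₃₄ + 16 * d₄₄

namespace DegreeRelations

variable {n b M n₁ n₂ n₃ n₄ d₁₂ d₁₃ d₁₄ d₂₂ d₂₃ d₂₄ d₃₃ d₃₄ d₄₄ : ℕ}

theorem zagreb_le
    (h : DegreeRelations n b M n₁ n₂ n₃ n₄ d₁₂ d₁₃ d₁₄ d₂₂ d₂₃ d₂₄ d₃₃ d₃₄ d₄₄)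
    (hb : 1 ≤ b) :
    M + 12 ≤ 4 * n + 16 * b ∧
      (M + 12 = 4 * n + 16 * b → n₃ = 0 ∧ d₁₄ = 0 ∧ d₄₄ + 2 = 2 * n₄) := by
  obtain ⟨_, _, _, _, _, _, _, _, h₄, _⟩ := h
  rcases Nat.eq_zero_or_pos n₄ with rfl | h0
  · exact ⟨by linarith, fun h ↦ absurd h (ne_of_lt (by linarith))⟩
  · have := h₄ h0
    refine ⟨by linarith, fun h ↦ ⟨?_, ?_, ?_⟩⟩ <;> linarith

theorem zagreb_le_of_three_mul_lt
    (h : DegreeRelations n b M n₁ n₂ n₃ n₄ d₁₂ d₁₃ d₁₄ d₂₂ d₂₃ d₂₄ d₃₃ d₃₄ d₄₄)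
    (hb : 1 ≤ b) (hn : 3 * b + 2 < n) :
    M + 20 ≤ 6 * n + 6 * b ∧
      (M + 20 = 6 * n + 6 * b → n₃ = 0 ∧ d₂₂ = 0 ∧ d₄₄ + 2 = 2 * n₄) := by
  obtain ⟨_, _, _, _, _, _, _, _, h₄, _⟩ := h
  rcases Nat.eq_zero_or_pos n₄ with rfl | h0
  · exact ⟨by linarith, fun h ↦ absurd h (ne_of_lt (by linarith))⟩
  · have := h₄ h0
    refine ⟨by linarith, fun h ↦ ⟨?_, ?_, ?_⟩⟩ <;> linarith

theorem zagreb_le_of_le_three_mul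
    (h : DegreeRelations n b M n₁ n₂ n₃ n₄ d₁₂ d₁₃ d₁₄ d₂₂ d₂₃ d₂₄ d₃₃ d₃₄ d₄₄)
    (hb : 2 * b + 2 < n) (hn : n ≤ 3 * b + 2) :
    M + 28 + 6 * b ≤ 10 * n ∧
      (M + 28 + 6 * b = 10 * n → n₂ = 0 ∧ d₃₃ = 0 ∧ d₄₄ + 2 = 2 * n₄) := by
  obtain ⟨_, _, _, _, _, _, _, _, h₄, _⟩ := h
  rcases Nat.eq_zero_or_pos n₄ with rfl | h0
  · exact ⟨by linarith, fun h ↦ absurd h (ne_of_lt (by linarith))⟩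
  · have := h₄ h0
    refine ⟨by linarith, fun h ↦ ⟨?_, ?_, ?_⟩⟩ <;> linarith

theorem zagreb_le_of_two_mul_lt
    (h : DegreeRelations n b M n₁ n₂ n₃ n₄ d₁₂ d₁₃ d₁₄ d₂₂ d₂₃ d₂₄ d₃₃ d₃₄ d₄₄)
    (hb : 2 * b + 2 < n) :
    M + 36 + 20 * b ≤ 16 * n ∧
      (M + 36 + 20 * b = 16 * n → n₂ = 0 ∧ d₁₄ = 0 ∧ d₄₄ + 2 = 2 * n₄) := by
  obtain ⟨_, _, _, _, _, _, _, _, h₄, _⟩ := h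
  rcases Nat.eq_zero_or_pos n₄ with rfl | h0
  · exact ⟨by linarith, fun h ↦ absurd h (ne_of_lt (by linarith))⟩
  · have := h₄ h0
    refine ⟨by linarith, fun h ↦ ⟨?_, ?_, ?_⟩⟩ <;> linarith

theorem zagreb_eq_of_deg_three_eq_zero
    (h : DegreeRelations n b M n₁ n₂ n₃ n₄ d₁₂ d₁₃ d₁₄ d₂₂ d₂₃ d₂₄ d₃₃ d₃₄ d₄₄)
    (h₃ : n₃ = 0) (h₄ : d₄₄ + 2 = 2 * n₄) (h0 : d₁₄ = 0 ∨ d₂₂ = 0) :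
    (5 * b + 4 ≤ n → M + 12 = 4 * n + 16 * b) ∧
      (n < 5 * b + 4 → 3 * b + 2 < n → M + 20 = 6 * n + 6 * b) := by
  obtain ⟨_, _, _, _, _, _, _, _, -, _⟩ := h
  rcases h0 with h0 | h0 <;> constructor <;> intros <;> linarith

theorem zagreb_eq_of_deg_two_eq_zero
    (h : DegreeRelations n b M n₁ n₂ n₃ n₄ d₁₂ d₁₃ d₁₄ d₂₂ d₂₃ d₂₄ d₃₃ d₃₄ d₄₄)
    (h₂ : n₂ = 0) (h₄ : d₄₄ + 2 = 2 * n₄) (h0 : d₁₄ = 0 ∨ d₃₃ = 0) :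
    (7 * b + 4 < 3 * n → M + 28 + 6 * b = 10 * n) ∧
      (3 * n ≤ 7 * b + 4 → M + 36 + 20 * b = 16 * n) := by
  obtain ⟨_, _, _, _, _, _, _, _, -, _⟩ := h
  rcases h0 with h0 | h0 <;> constructor <;> intros <;> linarith

theorem deg_three_eq_zero_iff
    (h : DegreeRelations n b M n₁ n₂ n₃ n₄ d₁₂ d₁₃ d₁₄ d₂₂ d₂₃ d₂₄ d₃₃ d₃₄ d₄₄) :
    n₃ = 0 ↔ n₄ = b ∧ (n₂ : ℚ) = (n : ℚ) - 3 * b - 2 ∧ n₁ = 2 * b + 2 ∧ n₃ = 0 := by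
  refine ⟨fun h₃ ↦ ⟨?_, ?_, ?_, h₃⟩, fun h ↦ h.2.2.2⟩
  · linarith [h.branching]
  · have : n₂ + 3 * b + 2 = n := by linarith [h.order, h.branching, h.degree_sum]
    rw [← this]
    push_cast
    ring
  · linarith [h.order, h.branching, h.degree_sum]

theorem deg_two_eq_zero_iff
    (h : DegreeRelations n b M n₁ n₂ n₃ n₄ d₁₂ d₁₃ d₁₄ d₂₂ d₂₃ d₂₄ d₃₃ d₃₄ d₄₄) :
    n₂ = 0 ↔ (n₄ : ℚ) = (n : ℚ) - 2 * b - 2 ∧ (n₃ : ℚ) = 3 * (b : ℚ) - n + 2 ∧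
      (n₁ : ℚ) = (n : ℚ) - b ∧ n₂ = 0 := by
  refine ⟨fun h₂ ↦ ?_, fun h ↦ h.2.2.2⟩
  have hn : (n₁ + n₂ + n₃ + n₄ : ℚ) = n := mod_cast h.order
  have hb : (n₃ + n₄ : ℚ) = b := mod_cast h.branching
  have hd : (n₁ + 2 * n₂ + 3 * n₃ + 4 * n₄ + 2 : ℚ) = 2 * n := mod_cast h.degree_sum
  have h₂' : (n₂ : ℚ) = 0 := mod_cast h₂
  exact ⟨by linarith, by linarith, by linarith, h₂⟩

end DegreeRelations

end Arithmetic

section Main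

variable {V : Type*} [Fintype V] {T : SimpleGraph V}

theorem Icc_one_four : Icc 1 4 = ({1, 2, 3, 4} : Finset ℕ) := rfl

theorem induce_branching_forest (hT : IsChemicalTree T) (hdeg : ∀ v, 1 ≤ deg T v)
    (hb : 1 ≤ numBranching T) :
    numDarts T 3 3 + 2 * numDarts T 3 4 + numDarts T 4 4 + 2 ≤ 2 * numBranching T ∧
      (numDarts T 3 3 + 2 * numDarts T 3 4 + numDarts T 4 4 + 2 = 2 * numBranching T →
        (T.induce {v | 3 ≤ deg T v}).Preconnected) := by
  classical
  have hne : Nonempty {v | 3 ≤ deg T v} :=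
    ((Set.ncard_pos (Set.toFinite _)).1 hb).to_subtype
  have hcard := two_mul_card_edgeSet_induce (G := T) {v | 3 ≤ deg T v}
  have hsum := sum_darts_eq hdeg hT.2 fun i j ↦ if 3 ≤ i ∧ 3 ≤ j then 1 else 0
  have hle := card_edgeSet_add_one_le_of_isAcyclic (hT.1.isAcyclic.induce {v | 3 ≤ deg T v})
  have hcomm := numDarts_comm T 4 3
  have hsum' : (∑ i ∈ Icc 1 4, ∑ j ∈ Icc 1 4, numDarts T i j * if 3 ≤ i ∧ 3 ≤ j then 1 else 0) =
      numDarts T 3 3 + numDarts T 3 4 + (numDarts T 4 3 + numDarts T 4 4) := by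
    simp [Icc_one_four]
  replace hcard := hcard.trans (Eq.trans (by congr!) (hsum.trans hsum'))
  rw [show Nat.card {v | 3 ≤ deg T v} = numBranching T from Nat.card_coe_set_eq _] at hle
  exact ⟨by omega, fun h ↦ (hle.2 (by omega)).connected.preconnected⟩

theorem induce_deg_four_forest (hT : IsChemicalTree T) (h4 : 1 ≤ nDeg T 4) :
    numDarts T 4 4 + 2 ≤ 2 * nDeg T 4 ∧
      (numDarts T 4 4 + 2 = 2 * nDeg T 4 ↔ (T.induce {v | deg T v = 4}).IsTree) := by
  classical
  have hne : Nonempty {v | deg T v = 4} :=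
    ((Set.ncard_pos (Set.toFinite _)).1 h4).to_subtype
  have hcard := two_mul_card_edgeSet_induce (G := T) {v | deg T v = 4}
  have hle := card_edgeSet_add_one_le_of_isAcyclic (hT.1.isAcyclic.induce {v | deg T v = 4})
  rw [← card_filter] at hcard
  replace hcard : 2 * Nat.card (T.induce {v | deg T v = 4}).edgeSet = numDarts T 4 4 := by
    rw [hcard, numDarts]
    congr
  rw [show Nat.card {v | deg T v = 4} = nDeg T 4 from Nat.card_coe_set_eq _] at hle
  refine ⟨by omega, fun h ↦ hle.2 (by omega), fun h ↦ ?_⟩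
  have := (isTree_iff_connected_and_card.1 h).2
  rw [show Nat.card {v | deg T v = 4} = nDeg T 4 from Nat.card_coe_set_eq _] at this
  omega

theorem degreeRelations (hT : IsChemicalTree T) (hb : 1 ≤ numBranching T) :
    DegreeRelations (Fintype.card V) (numBranching T) (M2 T)
      (nDeg T 1) (nDeg T 2) (nDeg T 3) (nDeg T 4)
      (numDarts T 1 2) (numDarts T 1 3) (numDarts T 1 4) (numDarts T 2 2) (numDarts T 2 3)
      (numDarts T 2 4) (numDarts T 3 3) (numDarts T 3 4) (numDarts T 4 4) := by
  classical
  obtain ⟨r, hr⟩ := (Set.ncard_pos (Set.toFinite _)).1 hb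
  have := nontrivial_of_deg hr
  have hdeg := one_le_deg_s4 hT.1.connected
  have h11 := numDarts_one_one hT.1.connected hr
  have hM := two_mul_M2 hdeg hT.2
  have h1 := mul_nDeg_eq hdeg hT.2 (i := 1) (by simp)
  have h2 := mul_nDeg_eq hdeg hT.2 (i := 2) (by simp)
  have h3 := mul_nDeg_eq hdeg hT.2 (i := 3) (by simp)
  have h4 := mul_nDeg_eq hdeg hT.2 (i := 4) (by simp)
  have hsum := sum_darts_eq hdeg hT.2 fun _ _ ↦ 1
  have hE := hT.1.card_edgeFinset
  have hD := dart_card_eq_twice_card_edges T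
  have hn : Fintype.card V = ∑ i ∈ Icc 1 4, nDeg T i := by
    simp_rw [nDeg_eq_card]
    rw [← card_univ]
    exact card_eq_sum_card_fiberwise fun v _ ↦ by simp [hdeg v, hT.2 v]
  have hb' : nDeg T 3 + nDeg T 4 = numBranching T := by
    rw [nDeg, nDeg, ← Set.ncard_union_eq (Set.disjoint_left.2 fun v ↦ by simp +contextual)
      (Set.toFinite _) (Set.toFinite _), numBranching]
    congr 1
    ext v
    have := hT.2 v
    simp only [Set.mem_union, Set.mem_ofPred_eq]
    omega
  rw [sum_const, smul_eq_mul, mul_one, card_univ] at hsum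
  have h21 := numDarts_comm T 2 1
  have h31 := numDarts_comm T 3 1
  have h41 := numDarts_comm T 4 1
  have h32 := numDarts_comm T 3 2
  have h42 := numDarts_comm T 4 2
  have h43 := numDarts_comm T 4 3
  simp only [Icc_one_four] at hM h1 h2 h3 h4 hsum hn
  simp at hM h1 h2 h3 h4 hsum hn
  constructor
  · linarith
  · linarith
  · linarith
  · linarith
  · linarith
  · exact hb'
  · linarith
  · exact (induce_branching_forest hT hdeg hb).1
  · exact fun h ↦ (induce_deg_four_forest hT h).1
  · linarith

theorem deg_ne_of_nDeg_eq_zero {i : ℕ} (h : nDeg T i = 0) (v : V) : deg T v ≠ i := fun hv ↦ by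
  rw [nDeg, Set.ncard_eq_zero (Set.toFinite _)] at h
  exact (h ▸ hv : v ∈ (∅ : Set V))

/-- Sufficient conditions for `MaxBranchProps` in terms of the numbers of adjacent pairs of vertices
of given degrees. -/
theorem maxBranchProps_of_induce_isTree (hT : IsChemicalTree T)
    (hS : (T.induce {v | 3 ≤ deg T v}).Preconnected)
    (h14 : numDarts T 1 4 = 0 ∨ nDeg T 3 = 0 ∨ numDarts T 3 3 = 0)
    (h22 : numDarts T 2 2 = 0 ∨ numDarts T 1 3 = 0 ∧ numDarts T 1 4 = 0)
    (h4 : nDeg T 4 ≠ 0) (htree : (T.induce {v | deg T v = 4}).IsTree) : MaxBranchProps T := by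
  refine ⟨fun u v p hp ↦ ?_, ?_, ?_, fun v hv ↦ ?_, Set.nonempty_of_ncard_ne_zero h4, htree⟩
  · by_contra hl
    obtain ⟨w, hw, hw2⟩ := exists_deg_two_of_isInternalPath hp hl
    have : 3 ≤ deg T w := support_subset_of_preconnected_induce hT.1.isAcyclic hS hp.2.2.1
      hp.2.2.2.1 hp.1 w hw
    omega
  · rintro ⟨u, v, hu, hv, huv⟩ x y hx hy hxy
    rcases h14 with h | h | h
    · exact (numDarts_eq_zero_iff T).1 h u v huv hu hv
    · exact deg_ne_of_nDeg_eq_zero h x hx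
    · exact (numDarts_eq_zero_iff T).1 h x y hxy hx hy
  · rintro ⟨u, v, hu, hv, huv⟩ x y p hp
    rcases h22 with h | ⟨h3, h4⟩
    · exact length_le_two_of_numDarts_two_two h hp
    · have hv3 := (numDarts_eq_zero_iff T).1 h3 u v huv hu
      have hv4 := (numDarts_eq_zero_iff T).1 h4 u v huv hu
      have := hT.2 v
      omega
  · exact ncard_adj_le_one_of_preconnected_induce hT.1.isAcyclic htree.connected.preconnected
      (v := v) (by simp [hv])

theorem maxBranchProps_iff_of_deg_three_eq_zero (hT : IsChemicalTree T)
    (hb : 1 ≤ numBranching T) (h3 : nDeg T 3 = 0) :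
    MaxBranchProps T ↔ numDarts T 4 4 + 2 = 2 * nDeg T 4 ∧
      (numDarts T 1 4 = 0 ∨ numDarts T 2 2 = 0) := by
  obtain ⟨r, hr⟩ := (Set.ncard_pos (Set.toFinite _)).1 hb
  have hR := degreeRelations hT hb
  have h4 : 1 ≤ nDeg T 4 := by linarith [hR.branching]
  have hforest := (induce_deg_four_forest hT h4).2
  have heq : {v | deg T v = 4} = {v | 3 ≤ deg T v} := by
    ext v
    have := hT.2 v
    have := deg_ne_of_nDeg_eq_zero h3 v
    simp only [Set.mem_ofPred_eq]
    omega
  constructor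
  · rintro ⟨-, -, hpend, -, -, htree⟩
    refine ⟨hforest.2 htree, or_iff_not_imp_left.2 fun h14 ↦ ?_⟩
    rw [numDarts_eq_zero_iff] at h14
    push Not at h14
    obtain ⟨u, v, huv, hu, hv⟩ := h14
    exact numDarts_two_two_eq_zero hT.1 hr (heq ▸ htree.connected.preconnected)
      (hpend ⟨u, v, hu, by omega, huv⟩)
  · rintro ⟨h44, h⟩
    have htree := hforest.1 h44
    refine maxBranchProps_of_induce_isTree hT (heq ▸ htree.connected.preconnected) (.inr (.inl h3))
      (h.symm.imp_right fun h ↦ ⟨?_, h⟩) (by omega) htree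
    have := hR.deg_three
    omega

theorem maxBranchProps_iff_of_deg_two_eq_zero (hT : IsChemicalTree T)
    (hb : 1 ≤ numBranching T) (h2 : nDeg T 2 = 0) (h4 : nDeg T 4 ≠ 0) :
    MaxBranchProps T ↔ numDarts T 4 4 + 2 = 2 * nDeg T 4 ∧
      (numDarts T 1 4 = 0 ∨ numDarts T 3 3 = 0) := by
  obtain ⟨r, hr⟩ := (Set.ncard_pos (Set.toFinite _)).1 hb
  have := nontrivial_of_deg hr
  have hR := degreeRelations hT hb
  have hforest := (induce_deg_four_forest hT (Nat.one_le_iff_ne_zero.2 h4)).2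
  constructor
  · rintro ⟨-, h33, -, -, -, htree⟩
    refine ⟨hforest.2 htree, or_iff_not_imp_left.2 fun h14 ↦ ?_⟩
    rw [numDarts_eq_zero_iff] at h14
    push Not at h14
    obtain ⟨u, v, huv, hu, hv⟩ := h14
    exact (numDarts_eq_zero_iff T).2 fun x y hxy hx hy ↦ h33 ⟨u, v, hu, hv, huv⟩ x y hx hy hxy
  · rintro ⟨h44, h⟩
    have := hR.deg_two
    refine maxBranchProps_of_induce_isTree hT
      ((induce_branching_forest hT (one_le_deg_s4 hT.1.connected) hb).2 ?_)
      (h.imp_right .inr) (.inl (by omega)) h4 (hforest.1 h44)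
    linarith [hR.deg_one, hR.deg_two, hR.deg_three, hR.deg_four, hR.order, hR.branching,
      hR.degree_sum]

end Main

end ChemTree

open ChemTree

theorem stmt_4 {V : Type*} [Fintype V] (n b : ℕ)
    (hcard : Fintype.card V = n) (hb1 : 1 ≤ b) (hb2 : (b : ℚ) < (n : ℚ) / 2 - 1)
    (T : SimpleGraph V) (hT : IsChemicalTree T) (hbr : numBranching T = b) :
    ((b : ℚ) ≤ ((n : ℚ) - 4) / 5 →
      (M2 T : ℚ) ≤ 4 * n + 16 * b - 12 ∧
        ((M2 T : ℚ) = 4 * n + 16 * b - 12 ↔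
          ((nDeg T 4 = b ∧ (nDeg T 2 : ℚ) = (n : ℚ) - 3 * b - 2 ∧
          nDeg T 1 = 2 * b + 2 ∧ nDeg T 3 = 0) ∧ MaxBranchProps T))) ∧
    (((n : ℚ) - 4) / 5 < (b : ℚ) → (b : ℚ) < ((n : ℚ) - 2) / 3 →
      (M2 T : ℚ) ≤ 6 * n + 6 * b - 20 ∧
        ((M2 T : ℚ) = 6 * n + 6 * b - 20 ↔
          ((nDeg T 4 = b ∧ (nDeg T 2 : ℚ) = (n : ℚ) - 3 * b - 2 ∧
          nDeg T 1 = 2 * b + 2 ∧ nDeg T 3 = 0) ∧ MaxBranchProps T))) ∧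
    (((n : ℚ) - 2) / 3 ≤ (b : ℚ) → (b : ℚ) < (3 * (n : ℚ) - 4) / 7 →
      (M2 T : ℚ) ≤ 10 * n - 6 * b - 28 ∧
        ((M2 T : ℚ) = 10 * n - 6 * b - 28 ↔
          (((nDeg T 4 : ℚ) = (n : ℚ) - 2 * b - 2 ∧ (nDeg T 3 : ℚ) = 3 * (b : ℚ) - n + 2 ∧
          (nDeg T 1 : ℚ) = (n : ℚ) - b ∧ nDeg T 2 = 0) ∧ MaxBranchProps T))) ∧
    ((3 * (n : ℚ) - 4) / 7 ≤ (b : ℚ) →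
      (M2 T : ℚ) ≤ 16 * n - 20 * b - 36 ∧
        ((M2 T : ℚ) = 16 * n - 20 * b - 36 ↔
          (((nDeg T 4 : ℚ) = (n : ℚ) - 2 * b - 2 ∧ (nDeg T 3 : ℚ) = 3 * (b : ℚ) - n + 2 ∧
          (nDeg T 1 : ℚ) = (n : ℚ) - b ∧ nDeg T 2 = 0) ∧ MaxBranchProps T))) := by
  subst hcard hbr
  have hR := degreeRelations hT hb1
  rw [← hR.deg_three_eq_zero_iff, ← hR.deg_two_eq_zero_iff]
  generalize hn : Fintype.card V = n at *
  generalize hb : numBranching T = b at *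
  have hb2' : 2 * b + 2 < n := by
    have : (2 * b + 2 : ℚ) < n := by linarith
    exact_mod_cast this
  refine ⟨fun h ↦ ?_, fun h h' ↦ ?_, fun h h' ↦ ?_, fun h ↦ ?_⟩
  · have hn₁ : 5 * b + 4 ≤ n := by
      have : (5 * b + 4 : ℚ) ≤ n := by linarith
      exact_mod_cast this
    obtain ⟨hle, heq⟩ := hR.zagreb_le hb1
    have hle' : (M2 T + 12 : ℚ) ≤ 4 * n + 16 * b := mod_cast hle
    refine ⟨by linarith, fun hM ↦ ?_, fun ⟨h₃, hprops⟩ ↦ ?_⟩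
    · have hM' : (M2 T + 12 : ℚ) = 4 * n + 16 * b := by linarith
      obtain ⟨h₃, h₁₄, h₄₄⟩ := heq (mod_cast hM')
      exact ⟨h₃, (maxBranchProps_iff_of_deg_three_eq_zero hT (hb ▸ hb1) h₃).2 ⟨h₄₄, .inl h₁₄⟩⟩
    · obtain ⟨h₄₄, h0⟩ := (maxBranchProps_iff_of_deg_three_eq_zero hT (hb ▸ hb1) h₃).1 hprops
      have hM : (M2 T + 12 : ℚ) = 4 * n + 16 * b :=
        mod_cast (hR.zagreb_eq_of_deg_three_eq_zero h₃ h₄₄ h0).1 hn₁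
      linarith
  · have hn₁ : n < 5 * b + 4 := by
      have : (n : ℚ) < 5 * b + 4 := by linarith
      exact_mod_cast this
    have hn₂ : 3 * b + 2 < n := by
      have : (3 * b + 2 : ℚ) < n := by linarith
      exact_mod_cast this
    obtain ⟨hle, heq⟩ := hR.zagreb_le_of_three_mul_lt hb1 hn₂
    have hle' : (M2 T + 20 : ℚ) ≤ 6 * n + 6 * b := mod_cast hle
    refine ⟨by linarith, fun hM ↦ ?_, fun ⟨h₃, hprops⟩ ↦ ?_⟩
    · have hM' : (M2 T + 20 : ℚ) = 6 * n + 6 * b := by linarith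
      obtain ⟨h₃, h₂₂, h₄₄⟩ := heq (mod_cast hM')
      exact ⟨h₃, (maxBranchProps_iff_of_deg_three_eq_zero hT (hb ▸ hb1) h₃).2 ⟨h₄₄, .inr h₂₂⟩⟩
    · obtain ⟨h₄₄, h0⟩ := (maxBranchProps_iff_of_deg_three_eq_zero hT (hb ▸ hb1) h₃).1 hprops
      have hM : (M2 T + 20 : ℚ) = 6 * n + 6 * b :=
        mod_cast (hR.zagreb_eq_of_deg_three_eq_zero h₃ h₄₄ h0).2 hn₁ hn₂
      linarith
  · have hn₁ : n ≤ 3 * b + 2 := by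
      have : (n : ℚ) ≤ 3 * b + 2 := by linarith
      exact_mod_cast this
    have hn₂ : 7 * b + 4 < 3 * n := by
      have : (7 * b + 4 : ℚ) < 3 * n := by linarith
      exact_mod_cast this
    obtain ⟨hle, heq⟩ := hR.zagreb_le_of_le_three_mul hb2' hn₁
    have hle' : (M2 T + 28 + 6 * b : ℚ) ≤ 10 * n := mod_cast hle
    refine ⟨by linarith, fun hM ↦ ?_, fun ⟨h₂, hprops⟩ ↦ ?_⟩
    · have hM' : (M2 T + 28 + 6 * b : ℚ) = 10 * n := by linarith
      obtain ⟨h₂, h₃₃, h₄₄⟩ := heq (mod_cast hM')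
      exact ⟨h₂, (maxBranchProps_iff_of_deg_two_eq_zero hT (hb ▸ hb1) h₂ (by omega)).2
        ⟨h₄₄, .inr h₃₃⟩⟩
    · have h₄ : nDeg T 4 ≠ 0 := by
        have := hR.order
        have := hR.branching
        have := hR.degree_sum
        omega
      obtain ⟨h₄₄, h0⟩ := (maxBranchProps_iff_of_deg_two_eq_zero hT (hb ▸ hb1) h₂ h₄).1 hprops
      have hM : (M2 T + 28 + 6 * b : ℚ) = 10 * n :=
        mod_cast (hR.zagreb_eq_of_deg_two_eq_zero h₂ h₄₄ h0).1 hn₂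
      linarith
  · have hn₁ : 3 * n ≤ 7 * b + 4 := by
      have : (3 * n : ℚ) ≤ 7 * b + 4 := by linarith
      exact_mod_cast this
    obtain ⟨hle, heq⟩ := hR.zagreb_le_of_two_mul_lt hb2'
    have hle' : (M2 T + 36 + 20 * b : ℚ) ≤ 16 * n := mod_cast hle
    refine ⟨by linarith, fun hM ↦ ?_, fun ⟨h₂, hprops⟩ ↦ ?_⟩
    · have hM' : (M2 T + 36 + 20 * b : ℚ) = 16 * n := by linarith
      obtain ⟨h₂, h₁₄, h₄₄⟩ := heq (mod_cast hM')
      exact ⟨h₂, (maxBranchProps_iff_of_deg_two_eq_zero hT (hb ▸ hb1) h₂ (by omega)).2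
        ⟨h₄₄, .inl h₁₄⟩⟩
    · have h₄ : nDeg T 4 ≠ 0 := by
        have := hR.order
        have := hR.branching
        have := hR.degree_sum
        omega
      obtain ⟨h₄₄, h0⟩ := (maxBranchProps_iff_of_deg_two_eq_zero hT (hb ▸ hb1) h₂ h₄).1 hprops
      have hM : (M2 T + 36 + 20 * b : ℚ) = 16 * n :=
        mod_cast (hR.zagreb_eq_of_deg_two_eq_zero h₂ h₄₄ h0).2 hn₁
      linarith
end

section
/- Let 3 ≤ k ≤ n−1 and let T be an n-vertex chemical tree with exactly k segments such that either M1(T') ≤ M1(T) for every n-vertex chemical tree T' with exactly k segments, or M2(T') ≤ M2(T) for every n-vertex chemical tree T' with exactly k segments. Then T contains at most two vertices of degree 3. -/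
open SimpleGraph

open ChemTree

namespace ChemTree


section Segments

variable {V : Type*} {G : SimpleGraph V}

lemma eq_of_adj_of_dist_lt (hG : G.IsTree) (r : V) {a b c : V} (hb : G.Adj a b) (hc : G.Adj a c)
    (hbd : G.dist r b < G.dist r a) (hcd : G.dist r c < G.dist r a) : b = c := by
  obtain ⟨p, hp, hpl⟩ := hG.connected.exists_path_of_dist r a
  have key : ∀ b, G.Adj a b → G.dist r b < G.dist r a → b = p.penultimate := by
    intro b hb hbd
    refine hG.isAcyclic.eq_penultimate_of_adj_end hp hb ?_
    by_contra hmem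
    obtain ⟨q, hq, hql⟩ := hG.connected.exists_path_of_dist r b
    have h := (hG.existsUnique_path r b).unique (hp.concat hmem hb) hq
    have hl := congrArg Walk.length h
    rw [Walk.length_concat] at hl
    omega
  rw [key b hb hbd, key c hc hcd]

lemma exists_adj_dist_lt (hG : G.IsTree) {r a : V} (ha : a ≠ r) :
    ∃ b, G.Adj a b ∧ G.dist r b < G.dist r a := by
  obtain ⟨p, hpl⟩ := hG.connected.exists_walk_length_eq_dist a r
  cases p with
  | nil => exact absurd rfl ha
  | @cons _ b _ h p =>
    refine ⟨b, h, ?_⟩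
    have h1 := G.dist_le p
    rw [Walk.length_cons] at hpl
    rw [G.dist_comm (u := r), G.dist_comm (u := r)]
    omega

/-- In a rooted tree, a path that has started to descend keeps descending. -/
lemma dist_le_of_isPath_cons (hG : G.IsTree) (r : V) {a b : V} (p : G.Walk a b) :
    ∀ {z : V} (h : G.Adj z a), (Walk.cons h p).IsPath → G.dist r z < G.dist r a →
      G.dist r a ≤ G.dist r b := by
  induction p with
  | nil => intros; rfl
  | @cons a c b h' p ih =>
    intro z h hp hd
    have hcz : c ≠ z := by
      rintro rfl
      simp at hp
    rcases hG.dist_eq_dist_add_one_of_adj r h' with h1 | h1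
    · exact absurd (eq_of_adj_of_dist_lt hG r h' h.symm (by omega) hd) hcz
    · have := ih h' hp.of_cons (by omega)
      omega

lemma exists_eq_or_eq_of_deg_eq_two {a z c : V} (ha : deg G a = 2) (hz : G.Adj a z)
    (hc : G.Adj a c) (hzc : z ≠ c) {b : V} (hb : G.Adj a b) : b = z ∨ b = c := by
  obtain ⟨x, y, hxy, hN⟩ := Set.ncard_eq_two.mp ha
  have h : ∀ t, G.Adj a t → t = x ∨ t = y := by
    intro t ht
    have : t ∈ G.neighborSet a := ht
    simpa [hN] using this
  have h1 := h z hz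
  have h2 := h c hc
  have h3 := h b hb
  grind

/-- In a rooted tree, a path ascending in its first step whose internal vertices have degree `2`
keeps ascending, provided that the root is not of degree `2`. -/
lemma dist_le_of_isPath_cons_of_deg (hG : G.IsTree) {r : V} (hr : deg G r ≠ 2) {a b : V}
    (p : G.Walk a b) :
    ∀ {z : V} (h : G.Adj z a), (Walk.cons h p).IsPath → G.dist r a < G.dist r z →
      (∀ w ∈ p.support, w ≠ b → deg G w = 2) → G.dist r b ≤ G.dist r a := by
  induction p with
  | nil => intros; rfl
  | @cons a c b h' p ih =>
    intro z h hp hd hw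
    have hcz : c ≠ z := by
      rintro rfl
      simp at hp
    have hab : a ≠ b := by
      rintro rfl
      simpa using hp.of_cons
    have ha : deg G a = 2 := hw a (by simp) hab
    obtain ⟨e, he, hed⟩ := exists_adj_dist_lt hG (a := a) (r := r) (by rintro rfl; exact hr ha)
    rcases exists_eq_or_eq_of_deg_eq_two ha h.symm h' hcz.symm he with rfl | rfl
    · omega
    · have := ih h' hp.of_cons hed (fun w hw' => hw w (by simp [hw']))
      omega

lemma end_eq_of_isPath_cons {a b : V} (p : G.Walk a b) :
    ∀ {z c : V} (h : G.Adj z a) (q : G.Walk a c), (Walk.cons h p).IsPath →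
      (Walk.cons h q).IsPath → deg G b ≠ 2 → deg G c ≠ 2 →
      (∀ w ∈ p.support, w ≠ b → deg G w = 2) → (∀ w ∈ q.support, w ≠ c → deg G w = 2) →
      b = c := by
  induction p with
  | nil =>
    intro z c h q _ _ hb hc _ hq
    by_contra hne
    exact hb (hq _ (by simp) hne)
  | @cons a e b h' p ih =>
    intro z c h q hp hq hb hc hpw hqw
    have hab : a ≠ b := by
      rintro rfl
      simpa using hp.of_cons
    have ha : deg G a = 2 := hpw a (by simp) hab
    have hez : e ≠ z := by
      rintro rfl
      simp at hp
    cases q with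
    | nil => exact absurd ha hc
    | @cons _ f _ h'' q =>
      have hfz : f ≠ z := by
        rintro rfl
        simp at hq
      obtain rfl : f = e := by
        rcases exists_eq_or_eq_of_deg_eq_two ha h.symm h' hez.symm h'' with h1 | h1
        · exact absurd h1 hfz
        · exact h1
      exact ih h' q hp.of_cons hq.of_cons hb hc (fun w hw => hpw w (by simp [hw]))
        (fun w hw => hqw w (by simp [hw]))

lemma exists_ascending_path (hG : G.IsTree) {r : V} (hr : deg G r ≠ 2) {v : V} (hv : v ≠ r) :
    ∃ (b : V) (p : G.Walk v b), p.IsPath ∧ 0 < p.length ∧ deg G b ≠ 2 ∧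
      G.dist r b < G.dist r v ∧ (∀ w ∈ p.support, w ≠ v → w ≠ b → deg G w = 2) ∧
      ∀ w ∈ p.support, G.dist r w ≤ G.dist r v := by
  induction hn : G.dist r v using Nat.strong_induction_on generalizing v with
  | _ n ih =>
    subst hn
    obtain ⟨a, ha, had⟩ := exists_adj_dist_lt hG hv
    by_cases h2 : deg G a = 2
    · obtain ⟨b, p, hp, -, hb, hbd, hw, hwd⟩ :=
        ih _ had (v := a) (by rintro rfl; exact hr h2) rfl
      refine ⟨b, Walk.cons ha p, ?_, by simp, hb, by omega, ?_, ?_⟩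
      · rw [Walk.cons_isPath_iff]
        refine ⟨hp, fun hmem => ?_⟩
        have := hwd v hmem
        omega
      · intro w hw' hwv hwb
        rw [Walk.support_cons, List.mem_cons] at hw'
        rcases hw' with rfl | hw'
        · exact absurd rfl hwv
        · by_cases hwa : w = a
          · rwa [hwa]
          · exact hw w hw' hwa hwb
      · intro w hw'
        rw [Walk.support_cons, List.mem_cons] at hw'
        rcases hw' with rfl | hw'
        · exact le_rfl
        · have := hwd w hw'
          omega
    · refine ⟨a, Walk.cons ha Walk.nil, by simp [ha.ne], by simp, h2, had, ?_, ?_⟩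
      · intro w hw h3 h4
        simp [h3, h4] at hw
      · intro w hw
        simp only [Walk.support_cons, Walk.support_nil, List.mem_cons, List.not_mem_nil,
          or_false] at hw
        rcases hw with rfl | rfl <;> omega

lemma IsSegment.symm {u v : V} {p : G.Walk u v} (h : IsSegment G p) : IsSegment G p.reverse :=
  ⟨h.1.reverse, by simpa using h.2.1, h.2.2.2.1, h.2.2.1,
    fun w hw h1 h2 => h.2.2.2.2 w (by simpa using hw) h2 h1⟩

lemma IsSegment.internal {u v a : V} {h : G.Adj u a} {p : G.Walk a v}
    (hs : IsSegment G (Walk.cons h p)) : ∀ w ∈ p.support, w ≠ v → deg G w = 2 := by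
  intro w hw hwv
  refine hs.2.2.2.2 w (by simp [hw]) ?_ hwv
  rintro rfl
  exact ((Walk.cons_isPath_iff h p).mp hs.1).2 hw

lemma IsSegment.dist_ne (hG : G.IsTree) {r : V} (hr : deg G r ≠ 2) {u v : V} {p : G.Walk u v}
    (hs : IsSegment G p) : G.dist r u ≠ G.dist r v := by
  cases p with
  | nil => simp [IsSegment] at hs
  | @cons _ a _ h p =>
    rcases hG.dist_eq_dist_add_one_of_adj r h with h1 | h1
    · have := dist_le_of_isPath_cons_of_deg hG hr p h hs.1 (by omega) hs.internal
      omega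
    · have := dist_le_of_isPath_cons hG r p h hs.1 (by omega)
      omega

lemma IsSegment.end_unique (hG : G.IsTree) {r u v v' : V} {p : G.Walk u v}
    {q : G.Walk u v'} (hp : IsSegment G p) (hq : IsSegment G q)
    (hv : G.dist r v < G.dist r u) (hv' : G.dist r v' < G.dist r u) : v = v' := by
  cases p with
  | nil => omega
  | @cons _ a _ h p =>
    cases q with
    | nil => omega
    | @cons _ b _ h' q =>
      obtain rfl : a = b := by
        refine eq_of_adj_of_dist_lt hG r h h' ?_ ?_
        · rcases hG.dist_eq_dist_add_one_of_adj r h with h1 | h1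
          · omega
          · have := dist_le_of_isPath_cons hG r p h hp.1 (by omega)
            omega
        · rcases hG.dist_eq_dist_add_one_of_adj r h' with h1 | h1
          · omega
          · have := dist_le_of_isPath_cons hG r q h' hq.1 (by omega)
            omega
      exact end_eq_of_isPath_cons p h q hp.1 hq.1 hp.2.2.2.1 hq.2.2.2.1 hp.internal hq.internal

/-- The segments of a tree are in bijection with the vertices of degree `≠ 2` other than any
fixed one of them. -/
theorem numSegments_eq (hG : G.IsTree) {r : V} (hr : deg G r ≠ 2) :
    numSegments G = ({v | deg G v ≠ 2} \ {r}).ncard := by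
  have hex : ∀ v : V, ∃ b : V, v ≠ r → deg G v ≠ 2 →
      G.dist r b < G.dist r v ∧ ∃ p : G.Walk v b, IsSegment G p := by
    intro v
    by_cases hv : v = r
    · exact ⟨v, fun h => absurd hv h⟩
    · obtain ⟨b, p, hp, hl, hb, hbd, hw, -⟩ := exists_ascending_path hG hr hv
      exact ⟨b, fun _ h2 => ⟨hbd, p, hp, hl, h2, hb, hw⟩⟩
  choose f hf using hex
  have himage : {s : Sym2 V | ∃ (u v : V) (p : G.Walk u v), s = s(u, v) ∧ IsSegment G p} =
      (fun v => s(v, f v)) '' ({v | deg G v ≠ 2} \ {r}) := by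
    have key : ∀ (u v : V) (p : G.Walk u v), IsSegment G p → G.dist r v < G.dist r u →
        s(u, v) ∈ (fun v => s(v, f v)) '' ({v | deg G v ≠ 2} \ {r}) := by
      intro u v p hp hd
      have hur : u ≠ r := by
        rintro rfl
        simp at hd
      obtain ⟨hfd, q, hq⟩ := hf u hur hp.2.2.1
      refine ⟨u, ⟨hp.2.2.1, hur⟩, ?_⟩
      rw [IsSegment.end_unique hG hp hq hd hfd]
    ext s
    constructor
    · rintro ⟨u, v, p, rfl, hp⟩
      rcases lt_or_gt_of_ne (hp.dist_ne hG hr) with h | h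
      · rw [Sym2.eq_swap]
        exact key v u p.reverse hp.symm h
      · exact key u v p hp h
    · rintro ⟨v, ⟨hv2, hvr⟩, rfl⟩
      obtain ⟨-, p, hp⟩ := hf v hvr hv2
      exact ⟨v, f v, p, rfl, hp⟩
  rw [numSegments, himage]
  refine Set.InjOn.ncard_image ?_
  rintro u ⟨hu2, hur⟩ v ⟨hv2, hvr⟩ huv
  have h1 := (hf u hur hu2).1
  have h2 := (hf v hvr hv2).1
  rcases Sym2.eq_iff.mp huv with ⟨h, -⟩ | ⟨h3, h4⟩
  · exact h
  · rw [h4] at h1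
    rw [← h3] at h2
    omega

end Segments

section Surgery

variable {V : Type*} {G H : SimpleGraph V}

lemma reachable_of_forall_adj_reachable (h : ∀ a b, G.Adj a b → H.Reachable a b) {a b : V}
    (hab : G.Reachable a b) : H.Reachable a b := by
  obtain ⟨p⟩ := hab
  induction p with
  | nil => exact .rfl
  | cons hadj _ ih => exact (h _ _ hadj).trans ih

/-- In a tree, an edge `wx` may be replaced by `ux` when `u` lies on the side of `w`. -/
lemma isTree_sup_edge_of_reachable {w x u : V} (h : (H ⊔ edge w x).IsTree) (hadj : ¬H.Adj w x)
    (hne : w ≠ x) (hr : H.Reachable w u) :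
    (H ⊔ edge u x).IsTree ∧ ¬H.Reachable u x := by
  have hnr : ¬H.Reachable u x := by
    intro hux
    have h1 : ¬ H.Reachable w x := by
      have := isAcyclic_sup_fromEdgeSet_iff.mp h.isAcyclic
      tauto
    exact h1 (hr.trans hux)
  have hux : u ≠ x := by
    rintro rfl
    exact hnr .rfl
  have hle : H ≤ H ⊔ edge u x := le_sup_left
  have hedge : (H ⊔ edge u x).Reachable u x :=
    Adj.reachable (Or.inr (by rw [edge_adj]; exact ⟨Or.inl ⟨rfl, rfl⟩, hux⟩))
  have hwx : (H ⊔ edge u x).Reachable w x := (hr.mono hle).trans hedge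
  have := h.connected.nonempty
  refine ⟨⟨⟨fun a b => ?_⟩, ?_⟩, hnr⟩
  · refine reachable_of_forall_adj_reachable (G := H ⊔ edge w x) ?_ (h.connected a b)
    rintro a b (hab | hab)
    · exact Adj.reachable (hle hab)
    · rw [edge_adj] at hab
      rcases hab with ⟨⟨rfl, rfl⟩ | ⟨rfl, rfl⟩, -⟩
      · exact hwx
      · exact hwx.symm
  · exact IsAcyclic.sup_edge_of_not_reachable hnr (h.isAcyclic.anti le_sup_left)

open Classical in
lemma exists_isPath_not_mem_support (hG : G.IsTree) {a b c : V}
    (hab : a ≠ b) (hac : a ≠ c) (hbc : b ≠ c) :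
    ∃ (w u v : V) (p : G.Walk u v), w ∉ p.support ∧ u ≠ v ∧ ({w, u, v} : Set V) = {a, b, c} := by
  obtain ⟨p, hp⟩ := (hG.connected a b).exists_isPath
  by_cases hc : c ∈ p.support
  · refine ⟨a, c, b, p.dropUntil c hc, fun ha => ?_, hbc.symm, by grind⟩
    have hq := hp
    rw [← p.take_spec hc] at hq
    exact hq.ne_of_mem_support_of_append hac (Walk.start_mem_support _) ha rfl
  · exact ⟨c, a, b, p, hc, hab, by grind⟩

open Classical in
lemma deg_sup_edge [Finite V] {a b : V} (hab : a ≠ b) (hadj : ¬G.Adj a b) (v : V) :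
    deg (G ⊔ edge a b) v = deg G v + (if v = a then 1 else 0) + (if v = b then 1 else 0) := by
  unfold deg
  by_cases ha : v = a
  · subst ha
    have : (G ⊔ edge v b).neighborSet v = insert b (G.neighborSet v) := by
      ext t
      simp only [mem_neighborSet, sup_adj, edge_adj, Set.mem_insert_iff]
      grind
    rw [this, Set.ncard_insert_of_notMem (by simpa using hadj)]
    simp [hab]
  · by_cases hb : v = b
    · subst hb
      have : (G ⊔ edge a v).neighborSet v = insert a (G.neighborSet v) := by
        ext t
        simp only [mem_neighborSet, sup_adj, edge_adj, Set.mem_insert_iff]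
        grind
      rw [this, Set.ncard_insert_of_notMem (by simpa [G.adj_comm] using hadj)]
      simp [ha]
    · have : (G ⊔ edge a b).neighborSet v = G.neighborSet v := by
        ext t
        simp only [mem_neighborSet, sup_adj, edge_adj]
        grind
      rw [this]
      simp [ha, hb]

end Surgery

section Zagreb

open Classical

variable {V : Type*} [Fintype V] {G : SimpleGraph V}

/-- The sum of a function over the neighbours of a vertex. -/
noncomputable def nbrSum (G : SimpleGraph V) (f : V → ℤ) (a : V) : ℤ :=
  ∑ b, if G.Adj a b then f b else 0

/-- The quadratic form of the adjacency matrix. -/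
noncomputable def adjForm (G : SimpleGraph V) (f : V → ℤ) : ℤ :=
  ∑ a, f a * nbrSum G f a

lemma nbrSum_add_single (f : V → ℤ) (u : V) (c : ℤ) (a : V) :
    nbrSum G (fun v => f v + if v = u then c else 0) a =
      nbrSum G f a + if G.Adj a u then c else 0 := by
  have h : ∀ b, (if G.Adj a b then f b + (if b = u then c else 0) else 0) =
      (if G.Adj a b then f b else 0) + if b = u then (if G.Adj a u then c else 0) else 0 := by
    intro b
    by_cases hb : b = u
    · subst hb
      split_ifs <;> simp
    · simp [hb]
  simp [nbrSum, h, Finset.sum_add_distrib]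

lemma adjForm_add_single (f : V → ℤ) (u : V) (c : ℤ) :
    adjForm G (fun v => f v + if v = u then c else 0) = adjForm G f + 2 * c * nbrSum G f u := by
  have h : ∀ a, (f a + if a = u then c else 0) * (nbrSum G f a + if G.Adj a u then c else 0) =
      f a * nbrSum G f a + c * (if G.Adj u a then f a else 0) +
        if a = u then c * nbrSum G f u else 0 := by
    intro a
    by_cases ha : a = u
    · subst ha
      simp
      ring
    · by_cases hadj : G.Adj u a
      · simp [ha, hadj, hadj.symm]
        ring
      · have hadj' : ¬G.Adj a u := fun h => hadj h.symm
        simp [ha, hadj, hadj']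
  simp only [adjForm, nbrSum_add_single, h, Finset.sum_add_distrib, ← Finset.mul_sum,
    Finset.sum_ite_eq', Finset.mem_univ, if_true]
  rw [nbrSum]
  ring

lemma nbrSum_sup_edge {a b : V} (hab : a ≠ b) (hadj : ¬G.Adj a b) (f : V → ℤ) (v : V) :
    nbrSum (G ⊔ edge a b) f v =
      nbrSum G f v + (if v = a then f b else 0) + if v = b then f a else 0 := by
  have h : nbrSum (G ⊔ edge a b) f v =
      ∑ t, ((if G.Adj v t then f t else 0) + (if t = b then (if v = a then f b else 0) else 0) +
        if t = a then (if v = b then f a else 0) else 0) := by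
    refine Finset.sum_congr rfl fun t _ => ?_
    simp only [sup_adj, edge_adj]
    have := fun h : G.Adj b a => hadj h.symm
    grind
  rw [h]
  simp only [nbrSum, Finset.sum_add_distrib, Finset.sum_ite_eq', Finset.mem_univ, if_true]

lemma adjForm_sup_edge {a b : V} (hab : a ≠ b) (hadj : ¬G.Adj a b) (f : V → ℤ) :
    adjForm (G ⊔ edge a b) f = adjForm G f + 2 * (f a * f b) := by
  simp only [adjForm, nbrSum_sup_edge hab hadj, mul_add, Finset.sum_add_distrib, mul_ite, mul_zero,
    Finset.sum_ite_eq', Finset.mem_univ, if_true]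
  ring

lemma two_mul_M2_s5 (G : SimpleGraph V) : 2 * (M2 G : ℤ) = adjForm G (fun v => (deg G v : ℤ)) := by
  have hd : adjForm G (fun v => (deg G v : ℤ)) =
      ∑ d : G.Dart, (deg G d.fst : ℤ) * deg G d.snd := by
    simp only [adjForm, nbrSum, Finset.mul_sum, mul_ite, mul_zero]
    rw [← Finset.sum_product', ← Finset.sum_filter]
    refine Finset.sum_bij' (fun xy h => ⟨xy, (Finset.mem_filter.1 h).2⟩)
      (fun d _ => (d.fst, d.snd)) ?_ ?_ ?_ ?_ ?_ <;> simp
  rw [hd, M2, ← Finset.sum_fiberwise_of_maps_to (s := Finset.univ)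
    (t := (Set.toFinite G.edgeSet).toFinset) (g := Dart.edge)
    (fun d _ => by simp)]
  push_cast
  rw [Finset.mul_sum]
  refine Finset.sum_congr rfl fun e he => ?_
  have he' : e ∈ G.edgeSet := by simpa using he
  have hc : ∀ d ∈ (Finset.univ.filter fun d : G.Dart => d.edge = e),
      (deg G d.fst : ℤ) * deg G d.snd =
        ((Sym2.lift ⟨fun u w => deg G u * deg G w, fun u w => Nat.mul_comm _ _⟩ e : ℕ) : ℤ) := by
    intro d hd
    rw [← (Finset.mem_filter.1 hd).2]
    exact (Nat.cast_mul _ _).symm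
  rw [Finset.sum_congr rfl hc, Finset.sum_const, G.dart_edge_fiber_card e he']
  simp

lemma deg_le_nbrSum {f : V → ℤ} (hf : ∀ a b, G.Adj a b → 1 ≤ f b) {u b : V} (hb : G.Adj u b) :
    (deg G u : ℤ) + (f b - 1) ≤ nbrSum G f u := by
  have hdeg : (deg G u : ℤ) = ∑ t, if G.Adj u t then 1 else 0 := by
    rw [deg, Set.ncard_eq_toFinset_card', Finset.sum_boole]
    congr 2
    ext t
    simp
  have hsing : f b - 1 = ∑ t, if t = b then f b - 1 else 0 := by simp
  rw [hdeg, hsing, nbrSum, ← Finset.sum_add_distrib]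
  refine Finset.sum_le_sum fun t _ => ?_
  by_cases ht : t = b
  · subst ht
    simp [hb]
  · by_cases hu : G.Adj u t
    · simpa [ht, hu] using hf u t hu
    · simp [ht, hu]

lemma exists_nbrSum_eq_of_deg_eq_one {u : V} (h : deg G u = 1) :
    ∃ z, G.neighborSet u = {z} ∧ ∀ f, nbrSum G f u = f z := by
  obtain ⟨z, hz⟩ := Set.ncard_eq_one.mp h
  refine ⟨z, hz, fun f => ?_⟩
  have : ∀ b, G.Adj u b ↔ b = z := fun b => by
    rw [← mem_neighborSet, hz, Set.mem_singleton_iff]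
  simp [nbrSum, this]

lemma exists_adj_two_le {d : V → ℕ} (hd : ∀ v, deg G v ≤ d v) {u w : V} (huw : u ≠ w)
    (hr : G.Reachable u w) (hw : 2 ≤ d w) : ∃ b, G.Adj u b ∧ 2 ≤ d b := by
  obtain ⟨p, hp⟩ := hr.exists_isPath
  cases p with
  | nil => exact absurd rfl huw
  | @cons _ b _ h p =>
    refine ⟨b, h, ?_⟩
    cases p with
    | nil => exact hw
    | @cons _ c _ h' p =>
      refine le_trans ?_ (hd b)
      have hcu : c ≠ u := by
        rintro rfl
        simp at hp
      have hsub : {u, c} ⊆ G.neighborSet b := by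
        rintro t (rfl | rfl)
        · exact h.symm
        · exact h'
      rw [← Set.ncard_pair hcu.symm]
      exact Set.ncard_le_ncard hsub

end Zagreb

section Exchange

open Classical

variable {V : Type*} [Fintype V]

/-- Replacing two edges `wx`, `wy` at a vertex `w` of degree `3` by `ux`, `vy`, where `u` and `v`
have degree `3`, preserves chemical trees and the number of segments and increases both Zagreb
indices. -/
theorem exists_isChemicalTree_of_exchange {G : SimpleGraph V} {w u v x y : V}
    (hT : IsChemicalTree (G ⊔ edge w x ⊔ edge w y)) (hwx : ¬G.Adj w x) (hwy : ¬G.Adj w y)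
    (hwx' : w ≠ x) (hwy' : w ≠ y) (hxy : x ≠ y) (huv : u ≠ v) (hwu : w ≠ u) (hwv : w ≠ v)
    (hru : G.Reachable w u) (hrv : G.Reachable w v)
    (hdw : deg (G ⊔ edge w x ⊔ edge w y) w = 3) (hdu : deg (G ⊔ edge w x ⊔ edge w y) u = 3)
    (hdv : deg (G ⊔ edge w x ⊔ edge w y) v = 3) :
    ∃ T' : SimpleGraph V, IsChemicalTree T' ∧
      numSegments T' = numSegments (G ⊔ edge w x ⊔ edge w y) ∧
      M1 (G ⊔ edge w x ⊔ edge w y) < M1 T' ∧ M2 (G ⊔ edge w x ⊔ edge w y) < M2 T' := by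
  set T := G ⊔ edge w x ⊔ edge w y with hTdef
  have hT1 : T = G ⊔ edge w y ⊔ edge w x := by rw [hTdef, sup_right_comm]
  have hwx1 : ¬(G ⊔ edge w y).Adj w x := by
    simp only [sup_adj, edge_adj]
    grind
  obtain ⟨htree1, hux1⟩ := isTree_sup_edge_of_reachable (hT1 ▸ hT.1) hwx1 hwx'
    (hru.mono le_sup_left)
  rw [sup_right_comm] at htree1
  have hux : ¬G.Reachable u x := fun h => hux1 (h.mono le_sup_left)
  have hwy1 : ¬(G ⊔ edge u x).Adj w y := by
    simp only [sup_adj, edge_adj]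
    grind
  obtain ⟨htree2, hvy1⟩ := isTree_sup_edge_of_reachable htree1 hwy1 hwy'
    (hrv.mono le_sup_left)
  have hvy : ¬G.Reachable v y := fun h => hvy1 (h.mono le_sup_left)
  have hruv : G.Reachable u v := hru.symm.trans hrv
  have hne_ux : u ≠ x := by rintro rfl; exact hux .rfl
  have hne_vy : v ≠ y := by rintro rfl; exact hvy .rfl
  have hne_vx : v ≠ x := by rintro rfl; exact hux hruv
  have hne_uy : u ≠ y := by rintro rfl; exact hvy hruv.symm
  have hadj_ux : ¬G.Adj u x := fun h => hux h.reachable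
  have hadj_vy : ¬(G ⊔ edge u x).Adj v y := fun h => hvy1 h.reachable
  have hadj_wy : ¬(G ⊔ edge w x).Adj w y := by
    simp only [sup_adj, edge_adj]
    grind
  set T' := G ⊔ edge u x ⊔ edge v y with hT'def
  have hdT : ∀ a, deg T a = deg G a + (if a = w then 1 else 0) + (if a = x then 1 else 0) +
      (if a = w then 1 else 0) + (if a = y then 1 else 0) := fun a => by
    rw [hTdef, deg_sup_edge hwy' hadj_wy, deg_sup_edge hwx' hwx]
  have hdT' : ∀ a, deg T' a = deg G a + (if a = u then 1 else 0) + (if a = x then 1 else 0) +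
      (if a = v then 1 else 0) + (if a = y then 1 else 0) := fun a => by
    rw [hT'def, deg_sup_edge hne_vy hadj_vy, deg_sup_edge hne_ux hadj_ux]
  have hd : ∀ a, (deg T' a : ℤ) = deg T a + (if a = u then 1 else 0) + (if a = v then 1 else 0) +
      (if a = w then -2 else 0) := fun a => by
    rw [hdT, hdT']
    split_ifs <;> push_cast <;> ring
  have hdu' : deg T' u = 4 := by
    have := hd u
    simp [huv, hwu.symm, hdu] at this
    omega
  have hdv' : deg T' v = 4 := by
    have := hd v
    simp [huv.symm, hwv.symm, hdv] at this
    omega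
  have hdw' : deg T' w = 1 := by
    have := hd w
    simp [hwu, hwv, hdw] at this
    omega
  have hdo : ∀ a, a ≠ u → a ≠ v → a ≠ w → deg T' a = deg T a := fun a h1 h2 h3 => by
    have := hd a
    simp [h1, h2, h3] at this
    omega
  have hGu : deg G u = 3 := by
    have := hdT u
    simp [hwu.symm, hne_ux, hne_uy] at this
    omega
  have hGv : deg G v = 3 := by
    have := hdT v
    simp [hwv.symm, hne_vx, hne_vy] at this
    omega
  have hGw : deg G w = 1 := by
    have := hdT w
    simp [hwx', hwy'] at this
    omega
  have hset : {a | deg T' a ≠ 2} = {a | deg T a ≠ 2} := by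
    ext a
    simp only [Set.mem_ofPred_eq]
    grind
  refine ⟨T', ⟨htree2, fun a => ?_⟩, ?_, ?_, ?_⟩
  · have := hT.2 a
    grind
  · rw [numSegments_eq htree2 (r := u) (by omega), numSegments_eq hT.1 (r := u) (by omega), hset]
  · have hsq : ∀ a, ((deg T' a : ℤ)) ^ 2 = (deg T a : ℤ) ^ 2 + (if a = u then 7 else 0) +
        (if a = v then 7 else 0) + (if a = w then -8 else 0) := by
      intro a
      by_cases h1 : a = u
      · subst h1
        simp [huv, hwu.symm, hdu, hdu']
      by_cases h2 : a = v
      · subst h2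
        simp [huv.symm, hwv.symm, hdv, hdv']
      by_cases h3 : a = w
      · subst h3
        simp [hwu, hwv, hdw, hdw']
      simp [h1, h2, h3, hdo a h1 h2 h3]
    have hM : (M1 T' : ℤ) = M1 T + 6 := by
      simp only [M1]
      push_cast
      simp only [hsq, Finset.sum_add_distrib, Finset.sum_ite_eq', Finset.mem_univ, if_true]
      ring
    omega
  · have hpos : ∀ a b, G.Adj a b → (1 : ℤ) ≤ deg T b := by
      intro a b hab
      have h1 : 0 < deg G b := (Set.ncard_pos).mpr ⟨a, hab.symm⟩
      have h2 := hdT b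
      omega
    have hdle : ∀ a, deg G a ≤ deg T a := fun a => by
      have := hdT a
      omega
    obtain ⟨z, hz, hNw⟩ := exists_nbrSum_eq_of_deg_eq_one hGw
    have hadj_w : ∀ a, G.Adj w a ↔ a = z := fun a => by
      rw [← mem_neighborSet, hz, Set.mem_singleton_iff]
    set f : V → ℤ := fun a => (deg T a : ℤ) with hf
    have hN : ∀ s : V, deg G s = 3 → s ≠ w → G.Reachable s w →
        4 ≤ nbrSum G f s ∧ (G.Adj s w → 5 ≤ nbrSum G f s) := by
      intro s hs hsw hr
      obtain ⟨b, hb, hb2⟩ := exists_adj_two_le hdle hsw hr (by omega)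
      have h1 := deg_le_nbrSum (f := f) hpos hb
      refine ⟨?_, fun h => ?_⟩
      · have : (2 : ℤ) ≤ f b := by
          simp only [hf]
          omega
        omega
      · have h2 := deg_le_nbrSum (f := f) hpos h
        have : f w = 3 := by simp [hf, hdw]
        omega
    obtain ⟨hu4, hu5⟩ := hN u hGu hwu.symm hru.symm
    obtain ⟨hv4, hv5⟩ := hN v hGv hwv.symm hrv.symm
    have hz4 : f z ≤ 4 := by
      have := hT.2 z
      simp only [hf]
      omega
    have hx1 : (1 : ℤ) ≤ f x := by
      have := hdT x
      simp only [hf]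
      simp [hwx'.symm, hxy] at this
      omega
    have hy1 : (1 : ℤ) ≤ f y := by
      have := hdT y
      simp only [hf]
      simp [hwy'.symm, hxy.symm] at this
      omega
    have hM : 2 * (M2 T : ℤ) = adjForm G f + 6 * f x + 6 * f y := by
      rw [two_mul_M2_s5, hTdef, adjForm_sup_edge hwy' hadj_wy, adjForm_sup_edge hwx' hwx, ← hTdef]
      simp only [hdw]
      push_cast
      ring
    have hM' : 2 * (M2 T' : ℤ) = adjForm G (fun a => (deg T' a : ℤ)) + 8 * f x + 8 * f y := by
      rw [two_mul_M2_s5, hT'def, adjForm_sup_edge hne_vy hadj_vy, adjForm_sup_edge hne_ux hadj_ux,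
        ← hT'def]
      simp only [hdu', hdv', hf, hdo x hne_ux.symm hne_vx.symm hwx'.symm,
        hdo y hne_uy.symm hne_vy.symm hwy'.symm]
      push_cast
      ring
    have hQ : adjForm G (fun a => (deg T' a : ℤ)) =
        adjForm G f + 2 * nbrSum G f u + 2 * (nbrSum G f v + if G.Adj v u then 1 else 0) -
          4 * (f z + (if G.Adj w u then 1 else 0) + (if G.Adj w v then 1 else 0)) := by
      rw [show (fun a => (deg T' a : ℤ)) = _ from funext hd, adjForm_add_single,
        adjForm_add_single, adjForm_add_single, nbrSum_add_single, nbrSum_add_single,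
        nbrSum_add_single, hNw]
      ring
    have hsym : ∀ s, G.Adj w s → G.Adj s w := fun s h => h.symm
    have hfu : f u = 3 := by simp [hf, hdu]
    have hfv : f v = 3 := by simp [hf, hdv]
    have hQ2 : (0 : ℤ) ≤ if G.Adj v u then 1 else 0 := by split_ifs <;> simp
    have key : (M2 T : ℤ) < M2 T' := by
      by_cases h1 : u = z
      · have h2 : v ≠ z := fun h => huv (h1.trans h.symm)
        have h3 := hu5 (hsym u ((hadj_w u).mpr h1))
        simp only [hadj_w, h1, h2, if_true, if_false] at hQ
        rw [h1] at hfu h3 hu4 hQ2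
        omega
      · by_cases h2 : v = z
        · have h3 := hv5 (hsym v ((hadj_w v).mpr h2))
          simp only [hadj_w, h1, h2, if_true, if_false] at hQ
          rw [h2] at hfv h3 hv4 hQ2
          omega
        · simp only [hadj_w, h1, h2, if_false] at hQ
          omega
    exact_mod_cast key

theorem exists_improvement {T : SimpleGraph V} (hT : IsChemicalTree T) (h : 2 < nDeg T 3) :
    ∃ T' : SimpleGraph V, IsChemicalTree T' ∧ numSegments T' = numSegments T ∧
      M1 T < M1 T' ∧ M2 T < M2 T' := by
  obtain ⟨a, b, c, ha, hb, hc, hab, hac, hbc⟩ := (Set.two_lt_ncard).mp h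
  obtain ⟨w, u, v, p, hwp, huv, hset⟩ := exists_isPath_not_mem_support hT.1 hab hac hbc
  have hmem : ∀ t ∈ ({w, u, v} : Set V), deg T t = 3 := by
    rw [hset]
    rintro t (rfl | rfl | rfl) <;> assumption
  have hwu : w ≠ u := by
    rintro rfl
    exact hwp p.start_mem_support
  have hwv : w ≠ v := by
    rintro rfl
    exact hwp p.end_mem_support
  have hdw := hmem w (by simp)
  obtain ⟨q, hq⟩ := (hT.1.connected w u).exists_isPath
  cases q with
  | nil => exact absurd rfl hwu
  | @cons _ z _ hz q =>
    have hwq : w ∉ q.support := ((Walk.cons_isPath_iff hz q).mp hq).2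
    have htwo : (T.neighborSet w \ {z}).ncard = 2 := by
      rw [Set.ncard_sdiff_singleton_of_mem ((mem_neighborSet T w z).mpr hz)]
      exact congrArg (· - 1) hdw
    obtain ⟨x, y, hxy, hN⟩ := Set.ncard_eq_two.mp htwo
    have hx : x ∈ T.neighborSet w \ {z} := by simp [hN]
    have hy : y ∈ T.neighborSet w \ {z} := by simp [hN]
    have hwx : T.Adj w x := hx.1
    have hwy : T.Adj w y := hy.1
    have hxz : x ≠ z := hx.2
    have hyz : y ≠ z := hy.2
    set G := T.deleteEdges {s(w, x), s(w, y)} with hG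
    have hGadj : ∀ s t, G.Adj s t ↔ T.Adj s t ∧ s(s, t) ≠ s(w, x) ∧ s(s, t) ≠ s(w, y) := by
      intro s t
      simp [hG, deleteEdges_adj]
    have havoid : ∀ {s t : V} (r : T.Walk s t), w ∉ r.support → G.Reachable s t := by
      intro s t r hr
      refine ⟨r.transfer G fun e he => ?_⟩
      induction e with
      | _ e1 e2 =>
        have h1 := r.fst_mem_support_of_mem_edges he
        have h2 := r.snd_mem_support_of_mem_edges he
        rw [mem_edgeSet, hGadj]
        refine ⟨r.adj_of_mem_edges he, ?_, ?_⟩ <;> (rw [Ne, Sym2.eq_iff]; grind)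
    have hwz : G.Reachable w z := by
      refine Adj.reachable ((hGadj w z).mpr ⟨hz, ?_, ?_⟩) <;> (rw [Ne, Sym2.eq_iff]; grind)
    have hru : G.Reachable w u := hwz.trans (havoid q hwq)
    have hrv : G.Reachable w v := hru.trans (havoid p hwp)
    have hTG : T = G ⊔ edge w x ⊔ edge w y := by
      ext s t
      simp only [sup_adj, hGadj, edge_adj, Ne, Sym2.eq_iff]
      have := hwx.symm
      have := hwy.symm
      have := hwx.ne
      have := hwy.ne
      grind
    have key := exists_isChemicalTree_of_exchange (G := G) (w := w) (u := u) (v := v) (x := x)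
      (y := y)
    rw [← hTG] at key
    exact key hT (by simp [hGadj]) (by simp [hGadj]) hwx.ne hwy.ne hxy huv hwu hwv hru hrv hdw
      (hmem u (by simp)) (hmem v (by simp))

end Exchange

end ChemTree

theorem stmt_5 {V : Type*} [Fintype V] (n k : ℕ)
    (hcard : Fintype.card V = n) (hk3 : 3 ≤ k) (hkn : k + 1 ≤ n)
    (T : SimpleGraph V) (hT : IsChemicalTree T) (hseg : numSegments T = k)
    (hmax : (∀ T' : SimpleGraph V, IsChemicalTree T' → numSegments T' = k →
        M1 T' ≤ M1 T) ∨
      (∀ T' : SimpleGraph V, IsChemicalTree T' → numSegments T' = k →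
        M2 T' ≤ M2 T)) :
    nDeg T 3 ≤ 2 := by
  by_contra! hlt
  obtain ⟨T', hT', hseg', hM1, hM2⟩ := exists_improvement hT hlt
  rcases hmax with h | h
  · exact absurd (h T' hT' (hseg'.trans hseg)) (not_le.mpr hM1)
  · exact absurd (h T' hT' (hseg'.trans hseg)) (not_le.mpr hM2)
end

section
/- Let 3 ≤ k ≤ n−1 and let T be an n-vertex chemical tree with exactly k segments such that M2(T') ≤ M2(T) for every n-vertex chemical tree T' with exactly k segments. If T contains a pendent vertex adjacent to a branching vertex, then T does not contain any pendent path of length greater than 2. -/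
open SimpleGraph

open ChemTree

namespace ChemTree

variable {V : Type*}

/-- Remove the vertex `m` (leaving it isolated) and join `a` to `b`. -/
def contract (G : SimpleGraph V) (m a b : V) (hab : a ≠ b) : SimpleGraph V where
  Adj p q := p ≠ m ∧ q ≠ m ∧ (G.Adj p q ∨ s(p, q) = s(a, b))
  symm := ⟨fun p q h => ⟨h.2.1, h.1, by rw [G.adj_comm, Sym2.eq_swap]; exact h.2.2⟩⟩
  loopless := ⟨fun p h => by
    rcases h.2.2 with h | h
    · exact G.loopless.irrefl p h
    · grind [Sym2.eq_iff]⟩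

/-- Replace the edge `ab` by the path `a, m, b`. -/
def subdivide (G : SimpleGraph V) (m a b : V) (ham : a ≠ m) (hbm : b ≠ m) :
    SimpleGraph V where
  Adj p q := (G.Adj p q ∧ s(p, q) ≠ s(a, b)) ∨ s(p, q) = s(a, m) ∨ s(p, q) = s(m, b)
  symm := ⟨fun p q h => by rw [G.adj_comm, Sym2.eq_swap]; exact h⟩
  loopless := ⟨fun p h => by
    rcases h with h | h | h
    · exact G.loopless.irrefl p h.1
    · grind [Sym2.eq_iff]
    · grind [Sym2.eq_iff]⟩

theorem subdivide_contract {G : SimpleGraph V} {m a b : V} (hab : a ≠ b) (ham : a ≠ m)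
    (hbm : b ≠ m) (hnab : ¬ G.Adj a b) (hm : G.neighborSet m = {a, b}) :
    subdivide (contract G m a b hab) m a b ham hbm = G := by
  have hm' : ∀ q, G.Adj m q ↔ q = a ∨ q = b := fun q => by
    rw [← mem_neighborSet, hm]; rfl
  ext p q
  have h1 := hm' p
  have h2 := hm' q
  have h3 := G.adj_comm p q
  have h4 := G.adj_comm a b
  have h5 := G.adj_comm m p
  simp only [subdivide, contract, Sym2.eq_iff]
  grind

/-- `y` can be reached from `x` inside the vertices satisfying `P`. -/
abbrev ReachIn (G : SimpleGraph V) (P : V → Prop) : V → V → Prop :=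
  Relation.ReflTransGen fun p q => G.Adj p q ∧ P p ∧ P q

theorem reachIn_of_subdivide {G : SimpleGraph V} {m a b : V} (ham : a ≠ m) (hbm : b ≠ m)
    (hab : G.Adj a b) (hiso : ∀ q, ¬ G.Adj m q) {P : V → Prop} {x y : V} (hx : x ≠ m)
    (hy : y ≠ m) (h : ReachIn (subdivide G m a b ham hbm) P x y) : ReachIn G P x y := by
  have key : (y ≠ m → ReachIn G P x y) ∧
      (y = m → ∃ c, (c = a ∨ c = b) ∧ P c ∧ ReachIn G P x c) := by
    clear hy
    induction h with
    | refl => exact ⟨fun _ => .refl, fun h => absurd h hx⟩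
    | @tail p q _ hpq ih =>
      obtain ⟨hadj, hp, hq⟩ := hpq
      have hba := hab.symm
      simp only [subdivide, Sym2.eq_iff] at hadj
      by_cases hpm : p = m
      · obtain ⟨c, hc, hPc, hxc⟩ := ih.2 hpm
        have hqab : q = a ∨ q = b := by
          have := hiso q
          grind
        have hxq : ReachIn G P x q := by
          by_cases hcq : c = q
          · exact hcq ▸ hxc
          · exact hxc.tail ⟨by grind, hPc, hq⟩
        exact ⟨fun _ => hxq, fun h => by grind⟩
      · have hxp := ih.1 hpm
        refine ⟨fun hqm => hxp.tail ⟨by grind, hp, hq⟩, fun hqm => ⟨p, ?_, hp, hxp⟩⟩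
        have := hiso p
        have := G.adj_comm m p
        grind
  exact key.1 hy

theorem reachIn_subdivide {G : SimpleGraph V} {m a b : V} (ham : a ≠ m) (hbm : b ≠ m)
    {P : V → Prop} (hm : P m) {x y : V}
    (h : ReachIn G P x y) : ReachIn (subdivide G m a b ham hbm) P x y := by
  induction h with
  | refl => exact .refl
  | @tail p q _ hpq ih =>
    obtain ⟨hadj, hp, hq⟩ := hpq
    by_cases he : s(p, q) = s(a, b)
    · refine (ih.tail ⟨?_, hp, hm⟩).tail ⟨?_, hm, hq⟩
      · simp only [subdivide, Sym2.eq_iff] at he ⊢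
        grind
      · simp only [subdivide, Sym2.eq_iff] at he ⊢
        grind
    · exact ih.tail ⟨Or.inl ⟨hadj, he⟩, hp, hq⟩

theorem ReachIn.exists_walk {G : SimpleGraph V} {P : V → Prop} {x y : V} (hx : P x)
    (h : ReachIn G P x y) : ∃ p : G.Walk x y, ∀ w ∈ p.support, P w := by
  induction h with
  | refl => exact ⟨.nil, by simpa using hx⟩
  | tail _ hpq ih =>
    obtain ⟨p, hp⟩ := ih
    refine ⟨p.concat hpq.1, fun w hw => ?_⟩
    rw [Walk.support_concat, List.mem_append, List.mem_singleton] at hw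
    rcases hw with hw | rfl
    · exact hp w hw
    · exact hpq.2.2

theorem reachIn_of_walk {G : SimpleGraph V} {P : V → Prop} {x y : V} (p : G.Walk x y)
    (h : ∀ w ∈ p.support, P w) : ReachIn G P x y := by
  induction p with
  | nil => exact .refl
  | cons hadj p ih =>
    simp only [Walk.support_cons, List.mem_cons, forall_eq_or_imp] at h
    exact .head ⟨hadj, h.1, h.2 _ p.start_mem_support⟩ (ih h.2)

theorem exists_isSegment_iff (G : SimpleGraph V) (x y : V) :
    (∃ p : G.Walk x y, IsSegment G p) ↔ x ≠ y ∧ deg G x ≠ 2 ∧ deg G y ≠ 2 ∧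
      ReachIn G (fun w => w = x ∨ w = y ∨ deg G w = 2) x y := by
  classical
  constructor
  · rintro ⟨p, hp, hl, hx, hy, hi⟩
    refine ⟨?_, hx, hy, reachIn_of_walk p fun w hw => ?_⟩
    · rintro rfl
      exact hl.ne' (Walk.length_eq_zero_iff.2 (Walk.isPath_iff_nil.1 hp))
    · have := hi w hw
      tauto
  · rintro ⟨hne, hx, hy, hr⟩
    obtain ⟨p, hp⟩ := ReachIn.exists_walk (P := fun w => w = x ∨ w = y ∨ deg G w = 2)
      (Or.inl rfl) hr
    refine ⟨p.bypass, p.bypass_isPath, ?_, hx, hy, fun w hw hwx hwy => ?_⟩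
    · rw [Nat.pos_iff_ne_zero]
      exact fun h => hne (Walk.eq_of_length_eq_zero h)
    · have := hp w (p.support_bypass_subset_support hw)
      tauto

/-- Moving a degree-two vertex from one edge to another preserves the number of segments. -/
theorem numSegments_subdivide_eq {G : SimpleGraph V} {m a b c e : V}
    (ham : a ≠ m) (hbm : b ≠ m) (hcm : c ≠ m) (hem : e ≠ m)
    (hab : G.Adj a b) (hce : G.Adj c e) (hiso : ∀ q, ¬ G.Adj m q)
    (hdeg : ∀ v, deg (subdivide G m a b ham hbm) v = deg (subdivide G m c e hcm hem) v)
    (hm : deg (subdivide G m a b ham hbm) m = 2) :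
    numSegments (subdivide G m a b ham hbm) = numSegments (subdivide G m c e hcm hem) := by
  unfold numSegments
  congr 1
  ext s
  simp only [Set.mem_ofPred_eq, exists_and_left]
  refine exists_congr fun x => exists_congr fun y => and_congr_right fun _ => ?_
  rw [exists_isSegment_iff, exists_isSegment_iff]
  simp only [← hdeg]
  refine and_congr_right fun _ => and_congr_right fun hx => and_congr_right fun hy => ?_
  have hxm : x ≠ m := fun h => hx (h ▸ hm)
  have hym : y ≠ m := fun h => hy (h ▸ hm)
  set P : V → Prop := fun w => w = x ∨ w = y ∨ deg (subdivide G m a b ham hbm) w = 2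
  have hPm : P m := Or.inr (Or.inr hm)
  exact ⟨fun h => reachIn_subdivide _ _ hPm
      (reachIn_of_subdivide _ _ hab hiso hxm hym h),
    fun h => reachIn_subdivide _ _ hPm
      (reachIn_of_subdivide _ _ hce hiso hxm hym h)⟩

theorem deg_subdivide_self {G : SimpleGraph V} {m a b : V} (ham : a ≠ m) (hbm : b ≠ m)
    (hab : G.Adj a b) (hiso : ∀ q, ¬ G.Adj m q) : deg (subdivide G m a b ham hbm) m = 2 := by
  have : (subdivide G m a b ham hbm).neighborSet m = {a, b} := by
    ext q
    have := hiso q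
    simp only [subdivide, mem_neighborSet, Sym2.eq_iff, Set.mem_insert_iff,
      Set.mem_singleton_iff]
    grind
  rw [deg, this, Set.ncard_pair hab.ne]

theorem deg_subdivide [Finite V] {G : SimpleGraph V} {m a b : V} (ham : a ≠ m) (hbm : b ≠ m)
    (hab : G.Adj a b) (hiso : ∀ q, ¬ G.Adj m q) {v : V} (hv : v ≠ m) :
    deg (subdivide G m a b ham hbm) v = deg G v := by
  have hne := hab.ne
  have hvm : m ∉ G.neighborSet v := fun h => hiso v h.symm
  unfold deg
  by_cases hva : v = a
  · subst hva
    rw [← Set.ncard_exchange hvm hab]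
    congr 1
    ext q
    simp only [subdivide, mem_neighborSet, Sym2.eq_iff, Set.mem_insert_iff, Set.mem_sdiff,
      Set.mem_singleton_iff]
    grind
  by_cases hvb : v = b
  · subst hvb
    rw [← Set.ncard_exchange hvm hab.symm]
    congr 1
    ext q
    simp only [subdivide, mem_neighborSet, Sym2.eq_iff, Set.mem_insert_iff, Set.mem_sdiff,
      Set.mem_singleton_iff]
    grind
  · congr 1
    ext q
    simp only [subdivide, mem_neighborSet, Sym2.eq_iff]
    grind

theorem sum_edgeSet_subdivide [Finite V] {G : SimpleGraph V} {m a b : V} (ham : a ≠ m)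
    (hbm : b ≠ m) (hab : G.Adj a b) (hiso : ∀ q, ¬ G.Adj m q) (w : Sym2 V → ℕ) :
    ∑ e ∈ (Set.toFinite (subdivide G m a b ham hbm).edgeSet).toFinset, w e + w s(a, b) =
      ∑ e ∈ (Set.toFinite G.edgeSet).toFinset, w e + (w s(a, m) + w s(m, b)) := by
  classical
  have hne := hab.ne
  have hset : (Set.toFinite (subdivide G m a b ham hbm).edgeSet).toFinset =
      insert s(a, m) (insert s(m, b)
        ((Set.toFinite G.edgeSet).toFinset.erase s(a, b))) := by
    ext e
    induction e with | _ p q =>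
    simp only [Set.Finite.mem_toFinset, mem_edgeSet, Finset.mem_insert, Finset.mem_erase,
      subdivide]
    tauto
  have h1 : s(m, b) ∉ (Set.toFinite G.edgeSet).toFinset.erase s(a, b) := by
    simp [hiso]
  have h2 : s(a, m) ∉ insert s(m, b) ((Set.toFinite G.edgeSet).toFinset.erase s(a, b)) := by
    have := hiso a
    simp [G.adj_comm a m, this, hne, ham]
  rw [hset, Finset.sum_insert h2, Finset.sum_insert h1]
  have := Finset.sum_erase_add (Set.toFinite G.edgeSet).toFinset w
    (a := s(a, b)) (by simpa using hab)
  omega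

/-- Moving a degree-two vertex from one edge to another preserves trees. -/
theorem isTree_subdivide_of_isTree [Finite V] {G : SimpleGraph V} {m a b c e : V}
    (ham : a ≠ m) (hbm : b ≠ m) (hcm : c ≠ m) (hem : e ≠ m)
    (hab : G.Adj a b) (hce : G.Adj c e) (hiso : ∀ q, ¬ G.Adj m q)
    (h : (subdivide G m a b ham hbm).IsTree) : (subdivide G m c e hcm hem).IsTree := by
  rw [isTree_iff_connected_and_card] at h ⊢
  obtain ⟨hconn, hcard⟩ := h
  constructor
  · have hreach : ∀ y, (subdivide G m c e hcm hem).Reachable c y := by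
      intro y
      by_cases hy : y = m
      · subst hy
        exact Adj.reachable (Or.inr (Or.inl rfl))
      · obtain ⟨p⟩ := hconn.preconnected c y
        have := reachIn_of_walk (P := fun _ => True) p (fun _ _ => trivial)
        obtain ⟨q, -⟩ := (reachIn_subdivide hcm hem trivial
          (reachIn_of_subdivide ham hbm hab hiso hcm hy this)).exists_walk trivial
        exact ⟨q⟩
    have : Nonempty V := ⟨m⟩
    exact ⟨fun x y => (hreach x).symm.trans (hreach y)⟩
  · have h1 := sum_edgeSet_subdivide ham hbm hab hiso (fun _ => 1)
    have h2 := sum_edgeSet_subdivide hcm hem hce hiso (fun _ => 1)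
    simp only [Finset.sum_const, smul_eq_mul, mul_one,
      ← Set.ncard_eq_toFinset_card] at h1 h2
    rw [Nat.card_coe_set_eq] at hcard ⊢
    omega

theorem eq_of_deg_eq_one_s7 {G : SimpleGraph V} {x y z : V} (hx : deg G x = 1)
    (hy : G.Adj x y) (hz : G.Adj x z) : y = z := by
  obtain ⟨w, hw⟩ := Set.ncard_eq_one.1 hx
  have h1 : y ∈ G.neighborSet x := hy
  have h2 : z ∈ G.neighborSet x := hz
  rw [hw] at h1 h2
  exact h1.trans h2.symm

/-- Moving a degree-two vertex adjacent to a pendent vertex and to another degree-two vertex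
onto an edge joining a pendent vertex to a branching vertex increases `M2`. -/
theorem exists_lt_M2 [Fintype V] {T : SimpleGraph V} (hT : IsChemicalTree T) {u v a m b : V}
    (hu : deg T u = 1) (hv : 3 ≤ deg T v) (huv : T.Adj u v) (ha : deg T a = 1)
    (hm : deg T m = 2) (hb : deg T b = 2) (ham : T.Adj a m) (hmb : T.Adj m b) :
    ∃ T' : SimpleGraph V, IsChemicalTree T' ∧ numSegments T' = numSegments T ∧
      M2 T < M2 T' := by
  have hab : a ≠ b := by rintro rfl; omega
  have hum : u ≠ m := by rintro rfl; omega
  have hvm : v ≠ m := by rintro rfl; omega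
  have hnab : ¬ T.Adj a b := fun h => hmb.ne (eq_of_deg_eq_one_s7 ha ham h)
  have hN : T.neighborSet m = {a, b} := by
    symm
    refine Set.eq_of_subset_of_ncard_le ?_ ?_
    · rintro q (rfl | rfl)
      exacts [ham.symm, hmb]
    · rw [Set.ncard_pair hab]
      exact hm.le
  have hTR := subdivide_contract hab ham.ne hmb.ne' hnab hN
  set R := contract T m a b hab with hR
  have hRab : R.Adj a b := ⟨ham.ne, hmb.ne', Or.inr rfl⟩
  have hRuv : R.Adj u v := ⟨hum, hvm, Or.inl huv⟩
  have hiso : ∀ q, ¬ R.Adj m q := fun q h => h.1 rfl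
  have hdeg : ∀ x, deg (subdivide R m a b ham.ne hmb.ne') x =
      deg (subdivide R m u v hum hvm) x := by
    intro x
    by_cases hx : x = m
    · rw [hx, deg_subdivide_self _ _ hRab hiso, deg_subdivide_self _ _ hRuv hiso]
    · rw [deg_subdivide _ _ hRab hiso hx, deg_subdivide _ _ hRuv hiso hx]
  have hseg := numSegments_subdivide_eq ham.ne hmb.ne' hum hvm hRab hRuv hiso hdeg
    (deg_subdivide_self _ _ hRab hiso)
  have htree := isTree_subdivide_of_isTree ham.ne hmb.ne' hum hvm hRab hRuv hiso
    (by rw [hTR]; exact hT.1)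
  have h1 := sum_edgeSet_subdivide ham.ne hmb.ne' hRab hiso
    (Sym2.lift ⟨fun u w => deg T u * deg T w, fun u w => Nat.mul_comm _ _⟩)
  have h2 := sum_edgeSet_subdivide hum hvm hRuv hiso
    (Sym2.lift ⟨fun u w => deg T u * deg T w, fun u w => Nat.mul_comm _ _⟩)
  rw [hTR] at hseg hdeg h1
  refine ⟨subdivide R m u v hum hvm, ⟨htree, fun x => hdeg x ▸ hT.2 x⟩, hseg.symm, ?_⟩
  simp only [M2, ← hdeg]
  simp only [Sym2.lift_mk, hu, ha, hm, hb] at h1 h2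
  omega

end ChemTree

theorem stmt_7 {V : Type*} [Fintype V] (n k : ℕ)
    (hcard : Fintype.card V = n) (hk3 : 3 ≤ k) (hkn : k + 1 ≤ n)
    (T : SimpleGraph V) (hT : IsChemicalTree T) (hseg : numSegments T = k)
    (hmax : ∀ T' : SimpleGraph V, IsChemicalTree T' → numSegments T' = k →
      M2 T' ≤ M2 T)
    (hpend : ∃ u v : V, deg T u = 1 ∧ 3 ≤ deg T v ∧ T.Adj u v) :
    ∀ (u v : V) (p : T.Walk u v), IsPendentPath T p → p.length ≤ 2 := by
  intro x y p hp
  by_contra! hlen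
  obtain ⟨u, v, hu, hv, huv⟩ := hpend
  obtain ⟨hpath, -, hx, -, hint⟩ := hp
  match p, hpath, hint, hlen with
  | .cons (v := m) h₁ (.cons (v := b) h₂ (.cons h₃ q)), hpath, hint, _ =>
    simp only [Walk.cons_isPath_iff, Walk.support_cons, List.mem_cons, not_or] at hpath
    obtain ⟨⟨⟨-, hbq⟩, -, hmq⟩, -, hxb, -⟩ := hpath
    have hm : deg T m = 2 := hint m (by simp) h₁.ne'
      (fun h => hmq (h ▸ q.end_mem_support))
    have hb : deg T b = 2 := hint b (by simp) (Ne.symm hxb)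
      (fun h => hbq (h ▸ q.end_mem_support))
    obtain ⟨T', hT', hs, hlt⟩ := exists_lt_M2 hT hu hv huv hx hm hb h₁ h₂
    exact absurd (hmax T' hT' (hs.trans hseg)) (by omega)
end
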